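/- arXiv:1701.03336 — 5 statements merged into one kernel-verified Lean document; each statement's English description precedes it below -/
import Mathlib

section
/- Let f be a bounded solution of the capillary problem on the sector Ω that is discontinuous at O, and assume the radial limit Rf(θ) exists for every θ ∈ (−α, α). Suppose f has an increasing upper fan: there exist α₂ ∈ (−α, α] and η > 0 such that Rf is constant on [α₂, α) and strictly increasing on [α₂ − η, α₂] ∩ (−α, α); set β⁺ = α − α₂. Let m ∈ [−1, 1] and σ = arccos(m) ∈ [0, π]. If A⁺_I(b) ≤ m b for every b > 0 (with bε < δ* in the defining integrals), then β⁺ ≥ σ. -/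
open Real Set Filter MeasureTheory Topology

noncomputable section

/-- The open circular sector with vertex `O = (0,0)`, half-opening angle `α`, radius `δ`. -/
def sector (α δ : ℝ) : Set (ℝ × ℝ) :=
  {p | ∃ r θ : ℝ, 0 < r ∧ r < δ ∧ -α < θ ∧ θ < α ∧ p = (r * Real.cos θ, r * Real.sin θ)}

/-- The gradient of `f : ℝ × ℝ → ℝ`. -/
def grad (f : ℝ × ℝ → ℝ) (p : ℝ × ℝ) : ℝ × ℝ :=
  (fderiv ℝ f p (1, 0), fderiv ℝ f p (0, 1))

/-- `Tf = ∇f / √(1 + |∇f|²)`. -/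
def Tf (f : ℝ × ℝ → ℝ) (p : ℝ × ℝ) : ℝ × ℝ :=
  ((grad f p).1 / Real.sqrt (1 + (grad f p).1 ^ 2 + (grad f p).2 ^ 2),
   (grad f p).2 / Real.sqrt (1 + (grad f p).1 ^ 2 + (grad f p).2 ^ 2))

/-- `Nf = div (Tf)`. -/
def Nf (f : ℝ × ℝ → ℝ) (p : ℝ × ℝ) : ℝ :=
  fderiv ℝ (fun q => (Tf f q).1) p (1, 0) + fderiv ℝ (fun q => (Tf f q).2) p (0, 1)

/-- Euclidean dot product on `ℝ × ℝ`. -/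
def dot (v w : ℝ × ℝ) : ℝ := v.1 * w.1 + v.2 * w.2

/-- `f` is a bounded solution of the capillary problem `Nf = κ f + lam₀` in the sector,
`Tf ⬝ ν = cos γ` on the two open edges, with contact angles `γp, γm : (0,δ) → [0,π]`. -/
structure IsCapillarySolution (α δ κ lam₀ : ℝ) (γp γm : ℝ → ℝ) (f : ℝ × ℝ → ℝ) : Prop where
  measurable_γp : Measurable γp
  measurable_γm : Measurable γm
  range_γp : ∀ s ∈ Ioo (0:ℝ) δ, γp s ∈ Icc 0 π
  range_γm : ∀ s ∈ Ioo (0:ℝ) δ, γm s ∈ Icc 0 π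
  bounded : ∃ M : ℝ, ∀ p ∈ sector α δ, |f p| ≤ M
  smooth : ContDiffOn ℝ 2 f (sector α δ)
  pde : ∀ p ∈ sector α δ, Nf f p = κ * f p + lam₀
  edgeP_smooth : ∀ s ∈ Ioo (0:ℝ) δ, ContDiffAt ℝ 1 f (s * Real.cos α, s * Real.sin α)
  edgeM_smooth : ∀ s ∈ Ioo (0:ℝ) δ, ContDiffAt ℝ 1 f (s * Real.cos α, -(s * Real.sin α))
  bcP : ∀ s ∈ Ioo (0:ℝ) δ,
    dot (Tf f (s * Real.cos α, s * Real.sin α)) (-Real.sin α, Real.cos α) = Real.cos (γp s)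
  bcM : ∀ s ∈ Ioo (0:ℝ) δ,
    dot (Tf f (s * Real.cos α, -(s * Real.sin α))) (-Real.sin α, -Real.cos α) = Real.cos (γm s)

/-- `L` is the radial limit `Rf(θ)` of `f` in direction `θ`. -/
def RadialLimitAt (f : ℝ × ℝ → ℝ) (θ L : ℝ) : Prop :=
  Tendsto (fun r => f (r * Real.cos θ, r * Real.sin θ)) (𝓝[>] (0:ℝ)) (𝓝 L)

/-- `f` is discontinuous at the corner `O`: `f(x)` has no limit as `Ω ∋ x → O`. -/
def DiscontinuousAtCorner (α δ : ℝ) (f : ℝ × ℝ → ℝ) : Prop :=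
  ¬ ∃ L : ℝ, Tendsto f (𝓝[sector α δ] ((0:ℝ), (0:ℝ))) (𝓝 L)

/-- `A_I(b) = liminf_{ε→0⁺} (1/ε) ∫₀^{bε} cos γ(t) dt`. -/
def fanAI (γ : ℝ → ℝ) (b : ℝ) : ℝ :=
  liminf (fun ε : ℝ => ε⁻¹ * ∫ t in Ioo (0:ℝ) (b * ε), Real.cos (γ t)) (𝓝[>] (0:ℝ))

/-- `A_S(b) = limsup_{ε→0⁺} (1/ε) ∫₀^{bε} cos γ(t) dt`. -/
def fanAS (γ : ℝ → ℝ) (b : ℝ) : ℝ :=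
  limsup (fun ε : ℝ => ε⁻¹ * ∫ t in Ioo (0:ℝ) (b * ε), Real.cos (γ t)) (𝓝[>] (0:ℝ))

lemma div_cone (Y1 Y2 h : ℝ × ℝ → ℝ) (c1 c2 d1 d2 e1 e2 : ℝ → ℝ)
    (hc1 : ∀ t, HasDerivAt c1 (d1 t) t) (hc2 : ∀ t, HasDerivAt c2 (d2 t) t)
    (hd1 : ∀ t, HasDerivAt d1 (e1 t) t) (hd2 : ∀ t, HasDerivAt d2 (e2 t) t)
    (ρ S t0 t1 : ℝ) (hρ : ρ ≤ S) (ht : t0 ≤ t1)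
    (hY1 : ∀ s ∈ Icc ρ S, ∀ t ∈ Icc t0 t1, ContinuousAt Y1 (s * c1 t, s * c2 t))
    (hY2 : ∀ s ∈ Icc ρ S, ∀ t ∈ Icc t0 t1, ContinuousAt Y2 (s * c1 t, s * c2 t))
    (hh : ∀ s ∈ Icc ρ S, ∀ t ∈ Icc t0 t1, ContinuousAt h (s * c1 t, s * c2 t))
    (hD : ∀ s ∈ Ioo ρ S, ∀ t ∈ Ioo t0 t1, DifferentiableAt ℝ Y1 (s * c1 t, s * c2 t) ∧
      DifferentiableAt ℝ Y2 (s * c1 t, s * c2 t) ∧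
      fderiv ℝ Y1 (s * c1 t, s * c2 t) (1, 0) + fderiv ℝ Y2 (s * c1 t, s * c2 t) (0, 1)
        = h (s * c1 t, s * c2 t)) :
    IntervalIntegrable (fun s => ∫ t in t0..t1,
      s * (c1 t * d2 t - c2 t * d1 t) * h (s * c1 t, s * c2 t)) volume ρ S ∧
    (∫ s in ρ..S, ∫ t in t0..t1, s * (c1 t * d2 t - c2 t * d1 t) * h (s * c1 t, s * c2 t)) =
    (∫ s in ρ..S, (c1 t1 * Y2 (s * c1 t1, s * c2 t1) - c2 t1 * Y1 (s * c1 t1, s * c2 t1)))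
    - (∫ s in ρ..S, (c1 t0 * Y2 (s * c1 t0, s * c2 t0) - c2 t0 * Y1 (s * c1 t0, s * c2 t0)))
    + (∫ t in t0..t1, S * (Y1 (S * c1 t, S * c2 t) * d2 t - Y2 (S * c1 t, S * c2 t) * d1 t))
    - (∫ t in t0..t1, ρ * (Y1 (ρ * c1 t, ρ * c2 t) * d2 t - Y2 (ρ * c1 t, ρ * c2 t) * d1 t)) := by
  classical
  have cc1 : Continuous c1 := continuous_iff_continuousAt.2 fun t => (hc1 t).continuousAt
  have cc2 : Continuous c2 := continuous_iff_continuousAt.2 fun t => (hc2 t).continuousAt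
  have cd1 : Continuous d1 := continuous_iff_continuousAt.2 fun t => (hd1 t).continuousAt
  have cd2 : Continuous d2 := continuous_iff_continuousAt.2 fun t => (hd2 t).continuousAt
  set Φ : ℝ × ℝ → ℝ × ℝ := fun x => (x.1 * c1 x.2, x.1 * c2 x.2) with hΦ
  have cΦ : Continuous Φ := by fun_prop
  set P : ℝ × ℝ → ℝ := fun x => x.1 * (Y1 (Φ x) * d2 x.2 - Y2 (Φ x) * d1 x.2) with hP
  set Q : ℝ × ℝ → ℝ := fun x => c1 x.2 * Y2 (Φ x) - c2 x.2 * Y1 (Φ x) with hQ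
  set H : ℝ × ℝ → ℝ := fun x => x.1 * (c1 x.2 * d2 x.2 - c2 x.2 * d1 x.2) * h (Φ x) with hH
  have comp : ∀ Y : ℝ × ℝ → ℝ, (∀ s ∈ Icc ρ S, ∀ t ∈ Icc t0 t1, ContinuousAt Y (s * c1 t, s * c2 t)) →
      ContinuousOn (fun x => Y (Φ x)) (Icc ρ S ×ˢ Icc t0 t1) := by
    intro Y hY x hx
    have : ContinuousAt Y (Φ x) := hY x.1 hx.1 x.2 hx.2
    exact (this.comp cΦ.continuousAt).continuousWithinAt
  have k1 := comp Y1 hY1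
  have k2 := comp Y2 hY2
  have k3 := comp h hh
  have cP : ContinuousOn P (Icc ρ S ×ˢ Icc t0 t1) := by
    refine continuous_fst.continuousOn.mul ((k1.mul ?_).sub (k2.mul ?_))
    · exact (cd2.comp continuous_snd).continuousOn
    · exact (cd1.comp continuous_snd).continuousOn
  have cQ : ContinuousOn Q (Icc ρ S ×ˢ Icc t0 t1) := by
    refine (ContinuousOn.mul ?_ k2).sub (ContinuousOn.mul ?_ k1)
    · exact (cc1.comp continuous_snd).continuousOn
    · exact (cc2.comp continuous_snd).continuousOn
  have cH : ContinuousOn H (Icc ρ S ×ˢ Icc t0 t1) := by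
    refine ContinuousOn.mul (Continuous.continuousOn ?_) k3
    fun_prop
  set O : Set (ℝ × ℝ) := Ioo ρ S ×ˢ Ioo t0 t1 with hO
  have key : ∀ x ∈ O, ∃ p q : ℝ × ℝ →L[ℝ] ℝ, HasFDerivAt P p x ∧ HasFDerivAt Q q x ∧
      p (1, 0) + q (0, 1) = H x := by
    intro x hx
    obtain ⟨D1, D2, hdiv⟩ := hD x.1 hx.1 x.2 hx.2
    have E1 := D1.hasFDerivAt
    have E2 := D2.hasFDerivAt
    have f1 : HasFDerivAt (fun x : ℝ × ℝ => x.1) (ContinuousLinearMap.fst ℝ ℝ ℝ) x := hasFDerivAt_fst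
    have f2 : HasFDerivAt (fun x : ℝ × ℝ => x.2) (ContinuousLinearMap.snd ℝ ℝ ℝ) x := hasFDerivAt_snd
    have g1 := (hc1 x.2).comp_hasFDerivAt x f2
    have g2 := (hc2 x.2).comp_hasFDerivAt x f2
    have g3 := (hd1 x.2).comp_hasFDerivAt x f2
    have g4 := (hd2 x.2).comp_hasFDerivAt x f2
    have hΦ' : HasFDerivAt Φ _ x := (f1.mul g1).prodMk (f1.mul g2)
    have y1 := HasFDerivAt.comp (g := Y1) (f := Φ) x E1 hΦ'
    have y2 := HasFDerivAt.comp (g := Y2) (f := Φ) x E2 hΦ'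
    refine ⟨_, _, f1.mul ((y1.mul g4).sub (y2.mul g3)), (g1.mul y2).sub (g2.mul y1), ?_⟩
    have lin : ∀ (L : ℝ × ℝ →L[ℝ] ℝ) (a b : ℝ), L (a, b) = a * L (1, 0) + b * L (0, 1) := by
      intro L a b
      have : ((a, b) : ℝ × ℝ) = a • (1, 0) + b • (0, 1) := by ext <;> simp
      rw [this, map_add, map_smul, map_smul]; simp
    simp only [hH, hΦ, Function.comp_apply, add_apply,
      sub_apply, smul_apply, ContinuousLinearMap.comp_apply,
      ContinuousLinearMap.prod_apply, ContinuousLinearMap.coe_fst', ContinuousLinearMap.coe_snd',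
      smul_eq_mul, mul_zero, mul_one, add_zero, zero_add]
    rw [lin (fderiv ℝ Y1 _) (c1 _) , lin (fderiv ℝ Y1 _) (x.1 * _), lin (fderiv ℝ Y2 _) (c1 _) , lin (fderiv ℝ Y2 _) (x.1 * _),
      ← hdiv]
    ring
  choose! p q hp hq hpq using key
  have := integral2_divergence_prod_of_hasFDerivAt_off_countable P Q
    (fun x => if x ∈ O then p x else H x • ContinuousLinearMap.fst ℝ ℝ ℝ)
    (fun x => if x ∈ O then q x else 0) ρ t0 S t1 ∅ countable_empty
    (by rwa [uIcc_of_le hρ, uIcc_of_le ht]) (by rwa [uIcc_of_le hρ, uIcc_of_le ht])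
    (by
      intro x hx
      rw [min_eq_left hρ, max_eq_right hρ, min_eq_left ht, max_eq_right ht] at hx
      have hx' : x ∈ O := hx.1
      simp only [hx', if_true]
      exact hp x hx')
    (by
      intro x hx
      rw [min_eq_left hρ, max_eq_right hρ, min_eq_left ht, max_eq_right ht] at hx
      have hx' : x ∈ O := hx.1
      simp only [hx', if_true]
      exact hq x hx')
  have eqH : ∀ x, (if x ∈ O then p x else H x • ContinuousLinearMap.fst ℝ ℝ ℝ) (1, 0) +
      (if x ∈ O then q x else 0) (0, 1) = H x := by
    intro x
    split_ifs with hx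
    · exact hpq x hx
    · simp
  simp only [eqH] at this
  have iH : IntegrableOn H (Icc ρ S ×ˢ Icc t0 t1) :=
    cH.integrableOn_compact (isCompact_Icc.prod isCompact_Icc)
  refine ⟨?_, this (by rwa [uIcc_of_le hρ, uIcc_of_le ht])⟩
  have iH2 : Integrable H ((volume.restrict (Ioc ρ S)).prod (volume.restrict (Ioc t0 t1))) := by
    rw [Measure.prod_restrict]
    exact iH.mono_set (prod_mono Ioc_subset_Icc_self Ioc_subset_Icc_self)
  rw [intervalIntegrable_iff_integrableOn_Ioc_of_le hρ]
  simp only [intervalIntegral.integral_of_le ht]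
  exact iH2.integral_prod_left

lemma second_mean (g φ : ℝ → ℝ) (u v K : ℝ) (huv : u ≤ v) (hg : ContinuousOn g (Icc u v))
    (hφ : MonotoneOn φ (Icc u v)) (h0 : φ u = 0)
    (hK : ∀ ξ ∈ Icc u v, ∫ x in ξ..v, g x ≤ K) :
    ∫ x in u..v, φ x * g x ≤ φ v * K := by
  have hv0 : 0 ≤ φ v := h0 ▸ hφ (left_mem_Icc.2 huv) (right_mem_Icc.2 huv) huv
  set M := φ v with hM
  -- monotone extension
  set ψ : ℝ → ℝ := fun x => φ (projIcc u v huv x) with hψ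
  have ψm : Monotone ψ := fun x y hxy =>
    hφ (projIcc u v huv x).2 (projIcc u v huv y).2 (monotone_projIcc huv hxy)
  have ψe : ∀ x ∈ Icc u v, ψ x = φ x := by
    intro x hx; simp only [hψ, projIcc_of_mem huv hx]
  have ψ0 : ∀ x ∈ Icc u v, 0 ≤ ψ x := by
    intro x hx; rw [ψe x hx, ← h0]; exact hφ (left_mem_Icc.2 huv) hx hx.1
  have ψM : ∀ x ∈ Icc u v, ψ x ≤ M := by
    intro x hx; rw [ψe x hx]; exact hφ hx (right_mem_Icc.2 huv) hx.2
  have mset : MeasurableSet {z : ℝ × ℝ | z.2 < ψ z.1} :=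
    measurableSet_lt measurable_snd (ψm.measurable.comp measurable_fst)
  set k : ℝ → ℝ → ℝ := fun x t => indicator {z : ℝ × ℝ | z.2 < ψ z.1} (fun z => g z.1) (x, t) with hk
  have e1 : ∀ x ∈ Icc u v, ∫ t in Ioc 0 M, k x t = φ x * g x := by
    intro x hx
    have : (fun t => k x t) = indicator (Iio (ψ x)) (fun _ => g x) := by
      ext t; simp only [hk, indicator, mem_ofPred_eq, mem_Iio]
    rw [this, setIntegral_indicator measurableSet_Iio]
    have hs : (Ioc 0 M ∩ Iio (ψ x) : Set ℝ) = Ioo 0 (ψ x) := by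
      ext t; constructor
      · rintro ⟨⟨a, b⟩, c⟩; exact ⟨a, c⟩
      · rintro ⟨a, c⟩; exact ⟨⟨a, (le_of_lt c).trans (ψM x hx)⟩, c⟩
    rw [hs, setIntegral_const, ← ψe x hx]
    simp [Measure.real, ψ0 x hx]
  have e2 : ∀ t, ∫ x in Ioc u v, k x t ≤ K := by
    intro t
    have : (fun x => k x t) = indicator {x | t < ψ x} g := by
      ext x; simp only [hk, indicator, mem_ofPred_eq]
    have mt : MeasurableSet {x | t < ψ x} := measurableSet_lt measurable_const ψm.measurable
    rw [this, setIntegral_indicator mt]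
    set T : Set ℝ := Ioc u v ∩ {x | t < ψ x} with hT
    have ub : ∀ x ∈ T, ∀ y ∈ Ioc u v, x ≤ y → y ∈ T := fun x hx y hy hxy =>
      ⟨hy, lt_of_lt_of_le hx.2 (ψm hxy)⟩
    rcases T.eq_empty_or_nonempty with hE | hN
    · rw [hE]; simpa using hK v (right_mem_Icc.2 huv)
    · have bd : BddBelow T := ⟨u, fun x hx => hx.1.1.le⟩
      set ξ := sInf T with hξ
      have hξu : u ≤ ξ := le_csInf hN fun x hx => hx.1.1.le
      obtain ⟨x0, hx0⟩ := hN
      have hξv : ξ ≤ v := (csInf_le bd hx0).trans hx0.1.2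
      have s1 : Ioc ξ v ⊆ T := by
        intro y hy
        obtain ⟨x, hx, hxy⟩ := exists_lt_of_csInf_lt ⟨x0, hx0⟩ hy.1
        exact ub x hx y ⟨hξu.trans_lt hy.1, hy.2⟩ hxy.le
      have s2 : T ⊆ Icc ξ v := fun x hx => ⟨csInf_le bd hx, hx.1.2⟩
      have ae : T =ᵐ[volume] Ioc ξ v := by
        refine Filter.EventuallyLE.antisymm ?_ (LE.le.eventuallyLE s1)
        exact (LE.le.eventuallyLE s2).trans Ioc_ae_eq_Icc.symm.le
      rw [setIntegral_congr_set ae, ← intervalIntegral.integral_of_le hξv]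
      exact hK ξ ⟨hξu, hξv⟩
  have gi : IntegrableOn g (Ioc u v) :=
    (hg.integrableOn_compact isCompact_Icc).mono_set Ioc_subset_Icc_self
  have int : Integrable (Function.uncurry k) ((volume.restrict (Ioc u v)).prod (volume.restrict (Ioc 0 M))) := by
    have : Function.uncurry k = indicator {z : ℝ × ℝ | z.2 < ψ z.1} (fun z => g z.1) := by
      ext ⟨x, t⟩; rfl
    rw [this]
    refine Integrable.indicator ?_ mset
    have := Integrable.mul_prod (μ := volume.restrict (Ioc u v)) (ν := volume.restrict (Ioc 0 M)) (f := g)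
      (g := fun _ => (1:ℝ)) gi (integrable_const _)
    simpa using this
  calc ∫ x in u..v, φ x * g x = ∫ x in Ioc u v, ∫ t in Ioc 0 M, k x t := by
        rw [intervalIntegral.integral_of_le huv]
        refine setIntegral_congr_fun measurableSet_Ioc fun x hx => (e1 x (Ioc_subset_Icc_self hx)).symm
    _ = ∫ t in Ioc 0 M, ∫ x in Ioc u v, k x t := integral_integral_swap int
    _ ≤ ∫ t in Ioc 0 M, K := by
        refine integral_mono int.integral_prod_right (integrable_const _) fun t => e2 t
    _ = M * K := by
        rw [setIntegral_const]; simp [Measure.real, hv0]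

lemma sector_isOpen (α δ : ℝ) (hα : α ∈ Ioo 0 π) : IsOpen (sector α δ) := by
  have h : sector α δ = polarCoord.symm '' (Ioo 0 δ ×ˢ Ioo (-α) α) := by
    ext p
    constructor
    · rintro ⟨r, θ, h1, h2, h3, h4, rfl⟩
      exact ⟨(r, θ), ⟨⟨h1, h2⟩, ⟨h3, h4⟩⟩, rfl⟩
    · rintro ⟨⟨r, θ⟩, ⟨⟨h1, h2⟩, ⟨h3, h4⟩⟩, rfl⟩
      exact ⟨r, θ, h1, h2, h3, h4, rfl⟩
  rw [h]
  refine OpenPartialHomeomorph.isOpen_image_symm_of_subset_target _ (isOpen_Ioo.prod isOpen_Ioo) ?_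
  rintro ⟨r, θ⟩ ⟨⟨h1, h2⟩, ⟨h3, h4⟩⟩
  have := hα.2
  exact ⟨h1, ⟨by simp only at *; linarith, by simp only at *; linarith⟩⟩

lemma sector_comb (α δ θ x y : ℝ) (hα : α ∈ Ioo 0 π) (hθ : θ ∈ Ioo (-α) α) (hd : α - θ < π)
    (hx : 0 < x) (hy : 0 < y) (hxy : x + y < δ) :
    (x * cos θ + y * cos α, x * sin θ + y * sin α) ∈ sector α δ := by
  set D := α - θ with hD
  have hD0 : 0 < D := by linarith [hθ.2]
  have sD : 0 < sin D := sin_pos_of_pos_of_lt_pi hD0 hd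
  set z : ℂ := ⟨x + y * cos D, y * sin D⟩ with hz
  have hzim : 0 < z.im := mul_pos hy sD
  have hz0 : z ≠ 0 := by intro h; rw [h] at hzim; simp at hzim
  set ψ := z.arg with hψ
  set r := ‖z‖ with hr
  have rpos : 0 < r := norm_pos_iff.2 hz0
  have c1 : r * cos ψ = x + y * cos D := Complex.norm_mul_cos_arg z
  have c2 : r * sin ψ = y * sin D := Complex.norm_mul_sin_arg z
  have ψ0 : 0 < ψ := by
    have h1 : 0 ≤ ψ := Complex.arg_nonneg_iff.2 hzim.le
    rcases h1.lt_or_eq with h | h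
    · exact h
    · rw [← h, sin_zero] at c2
      have := mul_pos hy sD
      linarith
  have ψD : ψ < D := by
    have h2 : r * sin (D - ψ) = x * sin D := by
      rw [sin_sub]
      linear_combination sin D * c1 - cos D * c2
    have h3 : 0 < sin (D - ψ) := by
      have := mul_pos hx sD
      rw [← h2] at this
      exact pos_of_mul_pos_right this rpos.le
    by_contra hcon
    push Not at hcon
    have h4 : sin (D - ψ) ≤ 0 := by
      apply sin_nonpos_of_nonpos_of_neg_pi_le
      · linarith
      · have := Complex.arg_le_pi z
        linarith
    linarith
  have hαe : α = θ + D := by rw [hD]; ring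
  refine ⟨r, θ + ψ, rpos, ?_, by linarith [hθ.1], by linarith, ?_⟩
  · have : r ^ 2 ≤ (x + y) ^ 2 := by
      have e : r ^ 2 = (x + y * cos D) ^ 2 + (y * sin D) ^ 2 := by
        rw [← c1, ← c2]
        linear_combination (-r^2) * (sin_sq_add_cos_sq ψ)
      rw [e]
      have e3 : (x + y * cos D) ^ 2 + (y * sin D) ^ 2 = (x + y) ^ 2 - 2 * (x * y) * (1 - cos D) := by
        linear_combination y ^ 2 * (sin_sq_add_cos_sq D)
      have := mul_nonneg (mul_pos hx hy).le (sub_nonneg.2 (cos_le_one D))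
      rw [e3]; linarith
    have := abs_le_of_sq_le_sq this (by positivity)
    linarith [le_abs_self r]
  · rw [hαe, cos_add, sin_add, cos_add, sin_add]
    ext
    · simp only
      linear_combination (-cos θ) * c1 + sin θ * c2
    · simp only
      linear_combination (-sin θ) * c1 - cos θ * c2

lemma sector_polar (α δ r θ : ℝ) (hr : 0 < r) (hr2 : r < δ) (hθ : θ ∈ Ioo (-α) α) :
    (r * cos θ, r * sin θ) ∈ sector α δ := ⟨r, θ, hr, hr2, hθ.1, hθ.2, rfl⟩

lemma cont_fderiv (f : ℝ × ℝ → ℝ) (p v : ℝ × ℝ) (h : ContDiffAt ℝ 1 f p) :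
    ContinuousAt (fun q => fderiv ℝ f q v) p := by
  have : ContinuousAt (fderiv ℝ f) p := h.continuousAt_fderiv (by norm_num)
  exact this.clm_apply continuousAt_const

lemma sqrt_pos' (a b : ℝ) : 0 < √(1 + a ^ 2 + b ^ 2) := Real.sqrt_pos.2 (by positivity)

lemma cont_Tf (f : ℝ × ℝ → ℝ) (p : ℝ × ℝ) (h : ContDiffAt ℝ 1 f p) :
    ContinuousAt (fun q => (Tf f q).1) p ∧ ContinuousAt (fun q => (Tf f q).2) p := by
  have h1 := cont_fderiv f p (1, 0) h
  have h2 := cont_fderiv f p (0, 1) h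
  have h3 : ContinuousAt (fun q => √(1 + (grad f q).1 ^ 2 + (grad f q).2 ^ 2)) p := by
    refine Real.continuous_sqrt.continuousAt.comp ?_
    exact (continuousAt_const.add (h1.pow 2)).add (h2.pow 2)
  exact ⟨h1.div h3 (sqrt_pos' _ _).ne', h2.div h3 (sqrt_pos' _ _).ne'⟩

lemma diff_Tf (f : ℝ × ℝ → ℝ) (p : ℝ × ℝ) (h : ContDiffAt ℝ 2 f p) :
    DifferentiableAt ℝ (fun q => (Tf f q).1) p ∧ DifferentiableAt ℝ (fun q => (Tf f q).2) p := by
  have h0 : DifferentiableAt ℝ (fderiv ℝ f) p :=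
    (h.fderiv_right (m := 1) (by norm_num)).differentiableAt (by norm_num)
  have h1 : DifferentiableAt ℝ (fun q => fderiv ℝ f q (1, 0)) p := h0.clm_apply (differentiableAt_const _)
  have h2 : DifferentiableAt ℝ (fun q => fderiv ℝ f q (0, 1)) p := h0.clm_apply (differentiableAt_const _)
  have h3 : DifferentiableAt ℝ (fun q => √(1 + (grad f q).1 ^ 2 + (grad f q).2 ^ 2)) p := by
    refine DifferentiableAt.sqrt ?_ ?_
    · exact ((differentiableAt_const _).add (h1.pow 2)).add (h2.pow 2)
    · positivity
  have h4 : DifferentiableAt ℝ (fun q => (√(1 + (grad f q).1 ^ 2 + (grad f q).2 ^ 2))⁻¹) p :=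
    DifferentiableAt.fun_inv h3 (sqrt_pos' _ _).ne'
  constructor
  · have := h1.mul h4
    simpa only [Tf, div_eq_mul_inv] using! this
  · have := h2.mul h4
    simpa only [Tf, div_eq_mul_inv] using! this

lemma Tf_sq (f : ℝ × ℝ → ℝ) (p : ℝ × ℝ) : (Tf f p).1 ^ 2 + (Tf f p).2 ^ 2 ≤ 1 := by
  simp only [Tf]
  rw [div_pow, div_pow, Real.sq_sqrt (by positivity), ← add_div, div_le_one (by positivity)]
  linarith

lemma Tf_dot_le (f : ℝ × ℝ → ℝ) (p : ℝ × ℝ) (a b L : ℝ) (hL : 0 ≤ L) (h : a ^ 2 + b ^ 2 ≤ L ^ 2) :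
    |(Tf f p).1 * a + (Tf f p).2 * b| ≤ L := by
  apply abs_le_of_sq_le_sq' _ hL |> abs_le.2
  have := Tf_sq f p
  nlinarith [sq_nonneg ((Tf f p).1 * b - (Tf f p).2 * a), sq_nonneg a, sq_nonneg b,
    mul_nonneg (add_nonneg (sq_nonneg a) (sq_nonneg b)) (sub_nonneg.2 this)]

lemma Tf_grad (f : ℝ × ℝ → ℝ) (p : ℝ × ℝ) (a b : ℝ) (h : a ^ 2 + b ^ 2 = 1) :
    a * (grad f p).1 + b * (grad f p).2 - 1 ≤
      (Tf f p).1 * (grad f p).1 + (Tf f p).2 * (grad f p).2 := by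
  simp only [Tf]
  set u := (grad f p).1
  set v := (grad f p).2
  set w := √(1 + u ^ 2 + v ^ 2) with hw
  have w0 : 0 < w := sqrt_pos' _ _
  have w2 : w ^ 2 = 1 + u ^ 2 + v ^ 2 := Real.sq_sqrt (by positivity)
  have e : u / w * u + v / w * v = w - 1 / w := by
    field_simp; linarith
  have w1 : 1 ≤ w := by nlinarith [sq_nonneg u, sq_nonneg v]
  have h1 : 1 / w ≤ 1 := by rw [div_le_one w0]; exact w1
  have h2 : a * u + b * v ≤ w := by
    refine le_of_abs_le (abs_le_of_sq_le_sq ?_ w0.le)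
    nlinarith [sq_nonneg (a * v - b * u)]
  rw [e]; linarith

def fluxQ (f : ℝ × ℝ → ℝ) (θ s : ℝ) : ℝ :=
  cos θ * (Tf f (s * cos θ, s * sin θ)).2 - sin θ * (Tf f (s * cos θ, s * sin θ)).1

def radG (f : ℝ × ℝ → ℝ) (r t : ℝ) : ℝ :=
  (Tf f (r * cos t, r * sin t)).1 * cos t - (Tf f (r * cos t, r * sin t)).2 * (-sin t)

lemma fluxQ_le (f : ℝ × ℝ → ℝ) (θ s : ℝ) : |fluxQ f θ s| ≤ 1 := by
  have := Tf_dot_le f (s * cos θ, s * sin θ) (-sin θ) (cos θ) 1 zero_le_one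
    (by have := sin_sq_add_cos_sq θ; nlinarith)
  unfold fluxQ
  convert this using 2
  ring

lemma radG_le (f : ℝ × ℝ → ℝ) (r t : ℝ) : |radG f r t| ≤ 1 := by
  have := Tf_dot_le f (r * cos t, r * sin t) (cos t) (sin t) 1 zero_le_one
    (by have := sin_sq_add_cos_sq t; nlinarith)
  unfold radG
  convert this using 2
  ring

lemma arc_flux (α δ : ℝ) (f h : ℝ × ℝ → ℝ) (C0 : ℝ)
    (reg : ∀ p ∈ sector α δ, ContDiffAt ℝ 2 f p)
    (hc : ∀ p ∈ sector α δ, ContinuousAt h p)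
    (hb : ∀ p ∈ sector α δ, |h p| ≤ C0)
    (pde : ∀ p ∈ sector α δ, Nf f p = h p)
    (ρ r ξ θ : ℝ) (hρ : 0 < ρ) (hρr : ρ ≤ r) (hr : r < δ) (hξ : -α < ξ) (hξθ : ξ ≤ θ) (hθ : θ < α) :
    r * (∫ t in ξ..θ, radG f r t) ≤ (∫ s in ρ..r, fluxQ f ξ s) - (∫ s in ρ..r, fluxQ f θ s)
      + ρ * (θ - ξ) + r * (r - ρ) * C0 * (θ - ξ) := by
  have mem : ∀ s ∈ Icc ρ r, ∀ t ∈ Icc ξ θ, (s * cos t, s * sin t) ∈ sector α δ := by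
    intro s hs t ht
    exact sector_polar α δ s t (hρ.trans_le hs.1) (hs.2.trans_lt hr)
      ⟨hξ.trans_le ht.1, ht.2.trans_lt hθ⟩
  have D := (div_cone (fun q => (Tf f q).1) (fun q => (Tf f q).2) h cos sin (fun t => -sin t) cos
    (fun t => -cos t) (fun t => -sin t) hasDerivAt_cos hasDerivAt_sin
    (fun t => (hasDerivAt_sin t).neg) hasDerivAt_cos ρ r ξ θ hρr hξθ
    (fun s hs t ht => (cont_Tf f _ ((reg _ (mem s hs t ht)).of_le (by norm_num))).1)
    (fun s hs t ht => (cont_Tf f _ ((reg _ (mem s hs t ht)).of_le (by norm_num))).2)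
    (fun s hs t ht => hc _ (mem s hs t ht))
    (fun s hs t ht => by
      have m := mem s (Ioo_subset_Icc_self hs) t (Ioo_subset_Icc_self ht)
      exact ⟨(diff_Tf f _ (reg _ m)).1, (diff_Tf f _ (reg _ m)).2, pde _ m⟩)).2
  have e1 : ‖∫ s in ρ..r, ∫ t in ξ..θ, s * (cos t * cos t - sin t * (-sin t)) *
      h (s * cos t, s * sin t)‖ ≤ (r * C0 * |θ - ξ|) * |r - ρ| := by
    apply intervalIntegral.norm_integral_le_of_norm_le_const
    intro s hs
    rw [uIoc_of_le hρr] at hs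
    apply intervalIntegral.norm_integral_le_of_norm_le_const
    intro t ht
    rw [uIoc_of_le hξθ] at ht
    have : cos t * cos t - sin t * (-sin t) = 1 := by have := sin_sq_add_cos_sq t; nlinarith
    rw [this, mul_one, norm_mul]
    have m := hb _ (mem s (Ioc_subset_Icc_self hs) t (Ioc_subset_Icc_self ht))
    have s0 : 0 < s := hρ.trans hs.1
    rw [Real.norm_eq_abs, Real.norm_eq_abs, abs_of_pos s0]
    exact mul_le_mul hs.2 m (abs_nonneg _) (s0.le.trans hs.2)
  have e2 : ‖∫ t in ξ..θ, ρ * radG f ρ t‖ ≤ ρ * |θ - ξ| := by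
    apply intervalIntegral.norm_integral_le_of_norm_le_const
    intro t ht
    rw [norm_mul, Real.norm_eq_abs, Real.norm_eq_abs, abs_of_pos hρ]
    exact mul_le_of_le_one_right hρ.le (radG_le f ρ t)
  rw [abs_of_nonneg (sub_nonneg.2 hξθ), Real.norm_eq_abs] at e1 e2
  rw [abs_of_nonneg (sub_nonneg.2 hρr)] at e1
  have e3 : ∫ t in ξ..θ, r * radG f r t = r * ∫ t in ξ..θ, radG f r t :=
    intervalIntegral.integral_const_mul _ _
  have D' : (∫ s in ρ..r, ∫ t in ξ..θ, s * (cos t * cos t - sin t * (-sin t)) *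
      h (s * cos t, s * sin t)) = (∫ s in ρ..r, fluxQ f θ s) - (∫ s in ρ..r, fluxQ f ξ s)
      + (∫ t in ξ..θ, r * radG f r t) - (∫ t in ξ..θ, ρ * radG f ρ t) := D
  have := (abs_le.1 e1).2
  have := (abs_le.1 e2).2
  rw [e3] at D'
  linarith

lemma arc_energy (α δ : ℝ) (f h : ℝ × ℝ → ℝ) (C0 c Mc L : ℝ)
    (reg : ∀ p ∈ sector α δ, ContDiffAt ℝ 2 f p)
    (hc : ∀ p ∈ sector α δ, ContinuousAt h p)
    (hb : ∀ p ∈ sector α δ, |h p| ≤ C0)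
    (hM : ∀ p ∈ sector α δ, |f p - c| ≤ Mc)
    (pde : ∀ p ∈ sector α δ, Nf f p = h p)
    (ρ r ξ θ : ℝ) (hρ : 0 < ρ) (hρr : ρ ≤ r) (hr : r < δ) (hξ : -α < ξ) (hξθ : ξ ≤ θ) (hθ : θ < α)
    (hL : ∀ s ∈ Icc ρ r, L ≤ f (s * cos θ, s * sin θ) - f (s * cos ξ, s * sin ξ)) :
    (L - (1 + Mc * C0) * r * (θ - ξ)) * (r - ρ) ≤
      (∫ s in ρ..r, (f (s * cos θ, s * sin θ) - c) * fluxQ f θ s)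
      - (∫ s in ρ..r, (f (s * cos ξ, s * sin ξ) - c) * fluxQ f ξ s)
      + r * (∫ t in ξ..θ, (f (r * cos t, r * sin t) - c) * radG f r t)
      + ρ * Mc * (θ - ξ) := by
  have mem : ∀ s ∈ Icc ρ r, ∀ t ∈ Icc ξ θ, (s * cos t, s * sin t) ∈ sector α δ := by
    intro s hs t ht
    exact sector_polar α δ s t (hρ.trans_le hs.1) (hs.2.trans_lt hr)
      ⟨hξ.trans_le ht.1, ht.2.trans_lt hθ⟩
  have reg1 : ∀ p ∈ sector α δ, ContDiffAt ℝ 1 f p := fun p hp => (reg p hp).of_le (by norm_num)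
  have cf : ∀ p ∈ sector α δ, ContinuousAt (fun q => f q - c) p := fun p hp =>
    (reg p hp).continuousAt.sub continuousAt_const
  have cg1 : ∀ p ∈ sector α δ, ContinuousAt (fun q => (grad f q).1) p := fun p hp =>
    cont_fderiv f p (1, 0) (reg1 p hp)
  have cg2 : ∀ p ∈ sector α δ, ContinuousAt (fun q => (grad f q).2) p := fun p hp =>
    cont_fderiv f p (0, 1) (reg1 p hp)
  set h2 : ℝ × ℝ → ℝ := fun q => (f q - c) * h q +
    ((Tf f q).1 * (grad f q).1 + (Tf f q).2 * (grad f q).2) with hh2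
  have ch2 : ∀ p ∈ sector α δ, ContinuousAt h2 p := fun p hp =>
    ((cf p hp).mul (hc p hp)).add (((cont_Tf f p (reg1 p hp)).1.mul (cg1 p hp)).add
      ((cont_Tf f p (reg1 p hp)).2.mul (cg2 p hp)))
  obtain ⟨Di, D⟩ := (div_cone (fun q => (f q - c) * (Tf f q).1) (fun q => (f q - c) * (Tf f q).2) h2
    cos sin (fun t => -sin t) cos
    (fun t => -cos t) (fun t => -sin t) hasDerivAt_cos hasDerivAt_sin
    (fun t => (hasDerivAt_sin t).neg) hasDerivAt_cos ρ r ξ θ hρr hξθ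
    (fun s hs t ht => (cf _ (mem s hs t ht)).mul (cont_Tf f _ (reg1 _ (mem s hs t ht))).1)
    (fun s hs t ht => (cf _ (mem s hs t ht)).mul (cont_Tf f _ (reg1 _ (mem s hs t ht))).2)
    (fun s hs t ht => ch2 _ (mem s hs t ht))
    (fun s hs t ht => by
      have m := mem s (Ioo_subset_Icc_self hs) t (Ioo_subset_Icc_self ht)
      obtain ⟨d1, d2⟩ := diff_Tf f _ (reg _ m)
      have df : DifferentiableAt ℝ (fun q => f q - c) (s * cos t, s * sin t) :=
        ((reg1 _ m).differentiableAt (by norm_num)).sub_const c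
      refine ⟨df.mul d1, df.mul d2, ?_⟩
      rw [fderiv_fun_mul df d1, fderiv_fun_mul df d2]
      simp only [add_apply, smul_apply, smul_eq_mul, fderiv_sub_const, hh2, grad]
      rw [← pde _ m, Nf]
      ring))
  -- lower bound of the inner integral
  have inner : ∀ s ∈ Icc ρ r, L - (1 + Mc * C0) * r * (θ - ξ) ≤
      ∫ t in ξ..θ, s * (cos t * cos t - sin t * (-sin t)) * h2 (s * cos t, s * sin t) := by
    intro s hs
    have s0 : 0 < s := hρ.trans_le hs.1
    set g : ℝ → ℝ := fun t => s * (-sin t * (grad f (s * cos t, s * sin t)).1 +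
      cos t * (grad f (s * cos t, s * sin t)).2) with hg
    have cmp : ∀ Y : ℝ × ℝ → ℝ, (∀ p ∈ sector α δ, ContinuousAt Y p) →
        ContinuousOn (fun t => Y (s * cos t, s * sin t)) (Icc ξ θ) := by
      intro Y hY t ht
      have h1 : ContinuousAt Y (s * cos t, s * sin t) := hY _ (mem s hs t ht)
      have h2 : Continuous (fun t : ℝ => (s * cos t, s * sin t)) := by fun_prop
      exact (ContinuousAt.comp (f := fun t : ℝ => (s * cos t, s * sin t)) h1 h2.continuousAt).continuousWithinAt
    have gcont : ContinuousOn g (Icc ξ θ) :=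
      continuousOn_const.mul ((continuous_sin.neg.continuousOn.mul (cmp _ cg1)).add
        (continuous_cos.continuousOn.mul (cmp _ cg2)))
    have FTC : ∫ t in ξ..θ, g t = f (s * cos θ, s * sin θ) - f (s * cos ξ, s * sin ξ) := by
      apply intervalIntegral.integral_eq_sub_of_hasDerivAt (f := fun t => f (s * cos t, s * sin t))
      · intro t ht
        rw [uIcc_of_le hξθ] at ht
        have d := ((reg1 _ (mem s hs t ht)).differentiableAt (by norm_num)).hasFDerivAt
        have e : HasDerivAt (fun t : ℝ => (s * cos t, s * sin t)) (s * (-sin t), s * cos t) t :=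
          ((hasDerivAt_cos t).const_mul s).prodMk ((hasDerivAt_sin t).const_mul s)
        have : HasDerivAt (fun t => f (s * cos t, s * sin t))
            (fderiv ℝ f (s * cos t, s * sin t) (s * (-sin t), s * cos t)) t := d.comp_hasDerivAt t e
        refine this.congr_deriv ?_
        have lin : ((s * (-sin t), s * cos t) : ℝ × ℝ) = (s * (-sin t)) • (1, 0) + (s * cos t) • (0, 1) := by
          ext <;> simp
        rw [lin, map_add, map_smul, map_smul]
        simp only [hg, grad, smul_eq_mul]
        ring
      · apply ContinuousOn.intervalIntegrable
        rwa [uIcc_of_le hξθ]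
    have step : ∫ t in ξ..θ, (g t - (1 + Mc * C0) * r) ≤
        ∫ t in ξ..θ, s * (cos t * cos t - sin t * (-sin t)) * h2 (s * cos t, s * sin t) := by
      apply intervalIntegral.integral_mono_on hξθ
      · apply ContinuousOn.intervalIntegrable
        rw [uIcc_of_le hξθ]
        exact gcont.sub continuousOn_const
      · apply ContinuousOn.intervalIntegrable
        rw [uIcc_of_le hξθ]
        exact ContinuousOn.mul (by fun_prop) (cmp _ ch2)
      · intro t ht
        have m := mem s hs t ht
        have one : cos t * cos t - sin t * (-sin t) = 1 := by have := sin_sq_add_cos_sq t; nlinarith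
        rw [one, mul_one]
        have k1 := Tf_grad f (s * cos t, s * sin t) (-sin t) (cos t) (by
          have := sin_sq_add_cos_sq t; nlinarith)
        have k2 : |(f (s * cos t, s * sin t) - c) * h (s * cos t, s * sin t)| ≤ Mc * C0 := by
          rw [abs_mul]
          exact mul_le_mul (hM _ m) (hb _ m) (abs_nonneg _) ((abs_nonneg _).trans (hM _ m))
        have k3 := (abs_le.1 k2).1
        have k4 : 0 ≤ Mc * C0 := (abs_nonneg _).trans k2
        have k5 : (-sin t * (grad f (s * cos t, s * sin t)).1 +
          cos t * (grad f (s * cos t, s * sin t)).2) - (1 + Mc * C0) ≤ h2 (s * cos t, s * sin t) := by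
          simp only [hh2]; linarith
        have k6 := mul_le_mul_of_nonneg_left k5 s0.le
        have k7 : (1 + Mc * C0) * s ≤ (1 + Mc * C0) * r :=
          mul_le_mul_of_nonneg_left hs.2 (by linarith)
        simp only [hg]
        linarith
    rw [intervalIntegral.integral_sub, FTC, intervalIntegral.integral_const, smul_eq_mul] at step
    · have := hL s hs
      linarith
    · apply ContinuousOn.intervalIntegrable
      rwa [uIcc_of_le hξθ]
    · exact intervalIntegrable_const
  have outer : (L - (1 + Mc * C0) * r * (θ - ξ)) * (r - ρ) ≤
      ∫ s in ρ..r, ∫ t in ξ..θ, s * (cos t * cos t - sin t * (-sin t)) * h2 (s * cos t, s * sin t) := by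
    have := intervalIntegral.integral_mono_on hρr intervalIntegrable_const Di inner
    rw [intervalIntegral.integral_const, smul_eq_mul] at this
    linarith
  have e2 : ‖∫ t in ξ..θ, ρ * ((f (ρ * cos t, ρ * sin t) - c) * radG f ρ t)‖ ≤ (ρ * Mc) * |θ - ξ| := by
    apply intervalIntegral.norm_integral_le_of_norm_le_const
    intro t ht
    rw [uIoc_of_le hξθ] at ht
    have m := hM _ (mem ρ ⟨le_rfl, hρr⟩ t (Ioc_subset_Icc_self ht))
    rw [norm_mul, norm_mul, Real.norm_eq_abs, Real.norm_eq_abs, Real.norm_eq_abs, abs_of_pos hρ]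
    refine mul_le_mul_of_nonneg_left ?_ hρ.le
    have := mul_le_mul m (radG_le f ρ t) (abs_nonneg _) ((abs_nonneg _).trans m)
    linarith
  rw [abs_of_nonneg (sub_nonneg.2 hξθ), Real.norm_eq_abs] at e2
  have e3 : ∫ t in ξ..θ, r * ((f (r * cos t, r * sin t) - c) * radG f r t)
      = r * ∫ t in ξ..θ, (f (r * cos t, r * sin t) - c) * radG f r t :=
    intervalIntegral.integral_const_mul _ _
  have e4 : ∀ θ s : ℝ, cos θ * ((f (s * cos θ, s * sin θ) - c) * (Tf f (s * cos θ, s * sin θ)).2) -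
      sin θ * ((f (s * cos θ, s * sin θ) - c) * (Tf f (s * cos θ, s * sin θ)).1) =
      (f (s * cos θ, s * sin θ) - c) * fluxQ f θ s := by
    intro θ s; unfold fluxQ; ring
  have e5 : ∀ s t : ℝ, (f (s * cos t, s * sin t) - c) * (Tf f (s * cos t, s * sin t)).1 * cos t -
      (f (s * cos t, s * sin t) - c) * (Tf f (s * cos t, s * sin t)).2 * (-sin t) =
      (f (s * cos t, s * sin t) - c) * radG f s t := by
    intro s t; unfold radG; ring
  simp only [e4, e5] at D
  rw [D, e3] at outer
  have := (abs_le.1 e2).1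
  linarith

set_option maxHeartbeats 1000000 in
lemma exists_flux (α δ : ℝ) (f h : ℝ × ℝ → ℝ) (R : ℝ → ℝ) (C0 M : ℝ) (hδ : 0 < δ)
    (reg : ∀ p ∈ sector α δ, ContDiffAt ℝ 2 f p)
    (hc : ∀ p ∈ sector α δ, ContinuousAt h p)
    (hb : ∀ p ∈ sector α δ, |h p| ≤ C0)
    (hM : ∀ p ∈ sector α δ, |f p| ≤ M)
    (pde : ∀ p ∈ sector α δ, Nf f p = h p)
    (hR : ∀ θ ∈ Ioo (-α) α, RadialLimitAt f θ (R θ))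
    (θ1 θ2 : ℝ) (h1 : -α < θ1) (h12 : θ1 < θ2) (h2 : θ2 < α)
    (mono : MonotoneOn R (Icc θ1 θ2)) (hlt : R θ1 < R θ2) (τ : ℝ) (hτ : 0 < τ) :
    ∀ᶠ r in 𝓝[>] (0:ℝ), ∃ θ ∈ Icc θ1 θ2, (1 - τ) * r ≤ ∫ s in (r ^ 2)..r, fluxQ f θ s := by
  have sub : Icc θ1 θ2 ⊆ Ioo (-α) α := fun t ht => ⟨h1.trans_le ht.1, ht.2.trans_lt h2⟩
  set D := R θ2 - R θ1 with hD
  have D0 : 0 < D := sub_pos.2 hlt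
  set c := R θ1 with hcdef
  set Mc := M + |c| with hMc
  have hM' : ∀ p ∈ sector α δ, |f p - c| ≤ Mc := fun p hp =>
    (abs_sub _ _).trans (add_le_add (hM p hp) le_rfl)
  have pmem : (δ / 2 * cos θ1, δ / 2 * sin θ1) ∈ sector α δ :=
    sector_polar α δ _ _ (by linarith) (by linarith) ⟨h1, h12.trans h2⟩
  have C00 : 0 ≤ C0 := (abs_nonneg _).trans (hb _ pmem)
  have M0 : 0 ≤ M := (abs_nonneg _).trans (hM _ pmem)
  have Mc0 : 0 ≤ Mc := add_nonneg M0 (abs_nonneg _)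
  set W := θ2 - θ1 with hW
  have W0 : 0 < W := sub_pos.2 h12
  set μ := D * τ / 20 with hμ
  have μ0 : 0 < μ := by positivity
  set C' := W * (1 + Mc * C0) + Mc * W + D * (1 + C0) * W + D with hC'
  have C'0 : 0 < C' := by positivity
  -- dominated convergence
  have dom : Tendsto (fun r : ℝ => ∫ t in θ1..θ2, |f (r * cos t, r * sin t) - R t|) (𝓝[>] 0) (𝓝 0) := by
    have key : Tendsto (fun r : ℝ => ∫ t in θ1..θ2, |f (r * cos t, r * sin t) - R t|) (𝓝[>] 0)
        (𝓝 (∫ t in θ1..θ2, (0:ℝ))) := by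
      have Rm : AEStronglyMeasurable R (volume.restrict (Ioc θ1 θ2)) :=
        (aemeasurable_restrict_of_monotoneOn measurableSet_Ioc
          (mono.mono Ioc_subset_Icc_self)).aestronglyMeasurable
      have small : ∀ᶠ r in 𝓝[>] (0:ℝ), r ∈ Ioo 0 δ := Ioo_mem_nhdsGT hδ
      have Rb : ∀ t ∈ Icc θ1 θ2, |R t| ≤ M := by
        intro t ht
        have := (hR t (sub ht)).abs
        refine le_of_tendsto this ?_
        filter_upwards [small] with r hr
        exact hM _ (sector_polar α δ r t hr.1 hr.2 (sub ht))
      refine intervalIntegral.tendsto_integral_filter_of_dominated_convergence (fun _ => 2 * M)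
        ?_ ?_ intervalIntegrable_const ?_
      · filter_upwards [small] with r hr
        rw [uIoc_of_le h12.le]
        have : ContinuousOn (fun t => f (r * cos t, r * sin t)) (Ioc θ1 θ2) := by
          intro t ht
          have k1 : ContinuousAt f (r * cos t, r * sin t) :=
            (reg _ (sector_polar α δ r t hr.1 hr.2 (sub (Ioc_subset_Icc_self ht)))).continuousAt
          have k2 : Continuous (fun t : ℝ => (r * cos t, r * sin t)) := by fun_prop
          exact (ContinuousAt.comp (f := fun t : ℝ => (r * cos t, r * sin t)) k1
            k2.continuousAt).continuousWithinAt
        exact ((this.aestronglyMeasurable measurableSet_Ioc).sub Rm).norm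
      · filter_upwards [small] with r hr
        refine Eventually.of_forall fun t ht => ?_
        rw [uIoc_of_le h12.le] at ht
        have ht' := Ioc_subset_Icc_self ht
        rw [Real.norm_eq_abs, abs_abs]
        have := (abs_sub (f (r * cos t, r * sin t)) (R t)).trans
          (add_le_add (hM _ (sector_polar α δ r t hr.1 hr.2 (sub ht'))) (Rb t ht'))
        linarith
      · refine Eventually.of_forall fun t ht => ?_
        rw [uIoc_of_le h12.le] at ht
        have := ((hR t (sub (Ioc_subset_Icc_self ht))).sub_const (R t)).abs
        simpa using this
    simpa using key
  have ev1 := dom.eventually (gt_mem_nhds μ0)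
  have near : ∀ θ ∈ Icc θ1 θ2, ∀ᶠ r in 𝓝[>] (0:ℝ), ∀ s ∈ Ioc 0 r,
      |f (s * cos θ, s * sin θ) - R θ| ≤ μ := by
    intro θ hθ
    have := (hR θ (sub hθ)).eventually (Metric.closedBall_mem_nhds (R θ) μ0)
    rw [eventually_nhdsWithin_iff, Metric.eventually_nhds_iff] at this
    obtain ⟨e, e0, he⟩ := this
    filter_upwards [Ioo_mem_nhdsGT e0] with r hr s hs
    have := he (y := s) (by rw [Real.dist_eq, sub_zero, abs_of_pos hs.1]; exact hs.2.trans_lt hr.2) hs.1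
    rwa [Real.dist_eq] at this
  have n1 := near θ1 (left_mem_Icc.2 h12.le)
  have n2 := near θ2 (right_mem_Icc.2 h12.le)
  have rs : 0 < D * τ / (4 * C') := by positivity
  filter_upwards [ev1, n1, n2, Ioo_mem_nhdsGT hδ, Ioo_mem_nhdsGT rs, Ioo_mem_nhdsGT zero_lt_one]
    with r ev1 n1 n2 hrδ hrs hr1
  by_contra hcon
  push Not at hcon
  have r0 : 0 < r := hr1.1
  have ρ0 : 0 < r ^ 2 := by positivity
  have ρr : r ^ 2 ≤ r := by nlinarith [hr1.2]
  have inIoc : ∀ s ∈ Icc (r ^ 2) r, s ∈ Ioc 0 r := fun s hs => ⟨ρ0.trans_le hs.1, hs.2⟩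
  set F2 := ∫ s in (r ^ 2)..r, fluxQ f θ2 s with hF2
  set K := (1 - τ) - F2 / r + (1 + C0) * W * r with hK
  have rK : r * K = (1 - τ) * r - F2 + (1 + C0) * W * r ^ 2 := by
    rw [hK]; field_simp
  have A : ∀ ξ ∈ Icc θ1 θ2, ∫ t in ξ..θ2, radG f r t ≤ K := by
    intro ξ hξ
    have := arc_flux α δ f h C0 reg hc hb pde (r ^ 2) r ξ θ2 ρ0 ρr hrδ.2 (h1.trans_le hξ.1) hξ.2 h2
    have hh := hcon ξ hξ
    refine le_of_mul_le_mul_left ?_ r0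
    rw [rK]
    have w1 : θ2 - ξ ≤ W := by rw [hW]; linarith [hξ.1]
    have w0 : 0 ≤ θ2 - ξ := by linarith [hξ.2]
    have w2 : r ^ 2 * (θ2 - ξ) ≤ r ^ 2 * W := mul_le_mul_of_nonneg_left w1 ρ0.le
    have w3 : r * (r - r ^ 2) * C0 * (θ2 - ξ) ≤ r ^ 2 * C0 * W := by
      apply mul_le_mul _ w1 w0 (by positivity)
      apply mul_le_mul_of_nonneg_right _ C00
      nlinarith
    linarith
  have memr : ∀ t ∈ Icc θ1 θ2, (r * cos t, r * sin t) ∈ sector α δ := fun t ht =>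
    sector_polar α δ r t hrδ.1 hrδ.2 (sub ht)
  have cmp : ∀ Y : ℝ × ℝ → ℝ, (∀ p ∈ sector α δ, ContinuousAt Y p) →
      ContinuousOn (fun t => Y (r * cos t, r * sin t)) (Icc θ1 θ2) := by
    intro Y hY t ht
    have k1 : ContinuousAt Y (r * cos t, r * sin t) := hY _ (memr t ht)
    have k2 : Continuous (fun t : ℝ => (r * cos t, r * sin t)) := by fun_prop
    exact (ContinuousAt.comp (f := fun t : ℝ => (r * cos t, r * sin t)) k1
      k2.continuousAt).continuousWithinAt
  have cf : ∀ p ∈ sector α δ, ContinuousAt f p := fun p hp => (reg p hp).continuousAt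
  have cT1 : ∀ p ∈ sector α δ, ContinuousAt (fun q => (Tf f q).1) p := fun p hp =>
    (cont_Tf f p ((reg p hp).of_le (by norm_num))).1
  have cT2 : ∀ p ∈ sector α δ, ContinuousAt (fun q => (Tf f q).2) p := fun p hp =>
    (cont_Tf f p ((reg p hp).of_le (by norm_num))).2
  have Gc : ContinuousOn (radG f r) (Icc θ1 θ2) :=
    ((cmp _ cT1).mul continuous_cos.continuousOn).sub
      ((cmp _ cT2).mul continuous_sin.neg.continuousOn)
  have C : ∫ t in θ1..θ2, (R t - c) * radG f r t ≤ D * K :=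
    second_mean (radG f r) (fun t => R t - c) θ1 θ2 K h12.le Gc
      (fun x hx y hy hxy => sub_le_sub_right (mono hx hy hxy) c) (by simp [hcdef]) A
  have B := arc_energy α δ f h C0 c Mc (D - 2 * μ) reg hc hb hM' pde (r ^ 2) r θ1 θ2 ρ0 ρr hrδ.2 h1
    h12.le h2 (by
      intro s hs
      have a1 := abs_le.1 (n1 s (inIoc s hs))
      have a2 := abs_le.1 (n2 s (inIoc s hs))
      linarith [a1.1, a1.2, a2.1, a2.2])
  -- radial pieces
  have rayc : ∀ θ ∈ Icc θ1 θ2, ContinuousOn (fluxQ f θ) (Icc (r ^ 2) r) ∧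
      ContinuousOn (fun s => f (s * cos θ, s * sin θ)) (Icc (r ^ 2) r) := by
    intro θ hθ
    have cmp2 : ∀ Y : ℝ × ℝ → ℝ, (∀ p ∈ sector α δ, ContinuousAt Y p) →
        ContinuousOn (fun s => Y (s * cos θ, s * sin θ)) (Icc (r ^ 2) r) := by
      intro Y hY s hs
      have k1 : ContinuousAt Y (s * cos θ, s * sin θ) := hY _
        (sector_polar α δ s θ (inIoc s hs).1 (hs.2.trans_lt hrδ.2) (sub hθ))
      have k2 : Continuous (fun s : ℝ => (s * cos θ, s * sin θ)) := by fun_prop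
      exact (ContinuousAt.comp (f := fun s : ℝ => (s * cos θ, s * sin θ)) k1
        k2.continuousAt).continuousWithinAt
    exact ⟨(continuousOn_const.mul (cmp2 _ cT2)).sub (continuousOn_const.mul (cmp2 _ cT1)), cmp2 _ cf⟩
  have ray : ∀ θ ∈ Icc θ1 θ2, (∀ s ∈ Ioc 0 r, |f (s * cos θ, s * sin θ) - R θ| ≤ μ) →
      |(∫ s in (r ^ 2)..r, (f (s * cos θ, s * sin θ) - c) * fluxQ f θ s) -
        (R θ - c) * ∫ s in (r ^ 2)..r, fluxQ f θ s| ≤ μ * r := by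
    intro θ hθ hn
    obtain ⟨q1, q2⟩ := rayc θ hθ
    rw [← intervalIntegral.integral_const_mul, ← intervalIntegral.integral_sub]
    · have : ‖∫ s in (r ^ 2)..r, ((f (s * cos θ, s * sin θ) - c) * fluxQ f θ s -
          (R θ - c) * fluxQ f θ s)‖ ≤ μ * |r - r ^ 2| := by
        apply intervalIntegral.norm_integral_le_of_norm_le_const
        intro s hs
        rw [uIoc_of_le ρr] at hs
        rw [← sub_mul, norm_mul, sub_sub_sub_cancel_right, Real.norm_eq_abs, Real.norm_eq_abs]
        have := mul_le_mul (hn s (inIoc s (Ioc_subset_Icc_self hs))) (fluxQ_le f θ s)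
          (abs_nonneg _) μ0.le
        linarith
      rw [Real.norm_eq_abs, abs_of_nonneg (sub_nonneg.2 ρr)] at this
      refine this.trans (mul_le_mul_of_nonneg_left (by linarith) μ0.le)
    · apply ContinuousOn.intervalIntegrable
      rw [uIcc_of_le ρr]
      exact (q2.sub continuousOn_const).mul q1
    · apply ContinuousOn.intervalIntegrable
      rw [uIcc_of_le ρr]
      exact continuousOn_const.mul q1
  have r1 := abs_le.1 (ray θ1 (left_mem_Icc.2 h12.le) n1)
  have r2 := abs_le.1 (ray θ2 (right_mem_Icc.2 h12.le) n2)
  have arc : (∫ t in θ1..θ2, (f (r * cos t, r * sin t) - c) * radG f r t) ≤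
      (∫ t in θ1..θ2, (R t - c) * radG f r t) + μ := by
    have Ri : IntervalIntegrable R volume θ1 θ2 := by
      apply MonotoneOn.intervalIntegrable; rwa [uIcc_of_le h12.le]
    have Gc' : ContinuousOn (radG f r) (uIcc θ1 θ2) := by rwa [uIcc_of_le h12.le]
    have fi : IntervalIntegrable (fun t => f (r * cos t, r * sin t)) volume θ1 θ2 := by
      apply ContinuousOn.intervalIntegrable; rw [uIcc_of_le h12.le]; exact cmp _ cf
    have i1 : IntervalIntegrable (fun t => (R t - c) * radG f r t) volume θ1 θ2 :=
      (Ri.sub intervalIntegrable_const).mul_continuousOn Gc'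
    have i2 : IntervalIntegrable (fun t => (f (r * cos t, r * sin t) - c) * radG f r t) volume θ1 θ2 :=
      (fi.sub intervalIntegrable_const).mul_continuousOn Gc'
    have i3 : IntervalIntegrable (fun t => |f (r * cos t, r * sin t) - R t|) volume θ1 θ2 :=
      (fi.sub Ri).abs
    have : (∫ t in θ1..θ2, (f (r * cos t, r * sin t) - c) * radG f r t) ≤
      ∫ t in θ1..θ2, ((R t - c) * radG f r t + |f (r * cos t, r * sin t) - R t|) := by
      apply intervalIntegral.integral_mono_on h12.le i2 (i1.add i3)
      intro t ht
      have e : |(f (r * cos t, r * sin t) - R t) * radG f r t| ≤ |f (r * cos t, r * sin t) - R t| := by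
        rw [abs_mul]; exact mul_le_of_le_one_right (abs_nonneg _) (radG_le f r t)
      have := (abs_le.1 e).2
      linarith
    rw [intervalIntegral.integral_add i1 i3] at this
    linarith
  have arc' := mul_le_mul_of_nonneg_left arc r0.le
  have C2 := mul_le_mul_of_nonneg_left C r0.le
  have rDK : r * (D * K) = D * ((1 - τ) * r - F2 + (1 + C0) * W * r ^ 2) := by
    rw [← rK]; ring
  have r1' : (R θ1 - c) * (∫ s in (r ^ 2)..r, fluxQ f θ1 s) = 0 := by simp [hcdef]
  have tot : (D - 2 * μ - (1 + Mc * C0) * r * W) * (r - r ^ 2) ≤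
      D * (1 - τ) * r + 3 * μ * r + (D * (1 + C0) * W + Mc * W) * r ^ 2 := by
    linarith [r1.1, r1.2, r2.1, r2.2]
  have g1 : (D - 2 * μ - (1 + Mc * C0) * r * W) * (r - r ^ 2) ≥
      D * r - 2 * μ * r - (D + W * (1 + Mc * C0)) * r ^ 2 := by
    have : (D - 2 * μ - (1 + Mc * C0) * r * W) * (r - r ^ 2) -
      (D * r - 2 * μ * r - (D + W * (1 + Mc * C0)) * r ^ 2) =
       2 * μ * r ^ 2 + (1 + Mc * C0) * W * (r * r ^ 2) := by ring
    have : 0 ≤ 2 * μ * r ^ 2 + (1 + Mc * C0) * W * (r * r ^ 2) := by positivity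
    linarith
  have g2 : r * (D * τ) ≤ r * (5 * μ + C' * r) := by
    rw [hC']; linarith only [tot, g1]
  have g3 := le_of_mul_le_mul_left g2 r0
  have g4 : C' * r ≤ D * τ / 4 := by
    have := hrs.2.le
    rw [le_div_iff₀ (by positivity)] at this
    linarith
  have : 0 < D * τ := by positivity
  rw [hμ] at g3
  linarith

lemma triangle_flux (α δ : ℝ) (f h : ℝ × ℝ → ℝ) (C0 : ℝ) (hα : α ∈ Ioo 0 π)
    (reg : ∀ p ∈ sector α δ, ContDiffAt ℝ 2 f p)
    (edge : ∀ s ∈ Ioo (0:ℝ) δ, ContDiffAt ℝ 1 f (s * cos α, s * sin α))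
    (hc : ∀ p, ContinuousAt f p → ContinuousAt h p)
    (hb : ∀ p ∈ sector α δ, |h p| ≤ C0)
    (pde : ∀ p ∈ sector α δ, Nf f p = h p)
    (θ a ρ ε l : ℝ) (hθ : θ ∈ Ioo (-α) α) (hd : α - θ < π) (ha : 0 < a)
    (hρ : 0 < ρ) (hρε : ρ ≤ ε) (hε : ε * (a + 1) < δ) (hl0 : 0 ≤ l)
    (hl : a ^ 2 - 2 * a * cos (α - θ) + 1 ≤ l ^ 2) :
    (∫ s in (a * ρ)..(a * ε), fluxQ f θ s) ≤ (∫ s in ρ..ε, fluxQ f α s) + (ε + ρ) * l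
      + ε * (ε - ρ) * (a * C0) := by
  have ε0 : 0 < ε := hρ.trans_le hρε
  set A1 := a * cos θ with hA1
  set A2 := a * sin θ with hA2
  set B1 := cos α - A1 with hB1
  set B2 := sin α - A2 with hB2
  set c1 : ℝ → ℝ := fun t => A1 + t * B1 with hc1
  set c2 : ℝ → ℝ := fun t => A2 + t * B2 with hc2
  have Bsq : B1 ^ 2 + B2 ^ 2 ≤ l ^ 2 := by
    refine le_trans (le_of_eq ?_) hl
    rw [hB1, hB2, hA1, hA2, cos_sub]
    linear_combination sin_sq_add_cos_sq α + a ^ 2 * sin_sq_add_cos_sq θ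
  have det : ∀ t, c1 t * B2 - c2 t * B1 = a * sin (α - θ) := by
    intro t
    simp only [hc1, hc2]
    rw [hB1, hB2, hA1, hA2, sin_sub]
    ring
  have mem : ∀ s ∈ Icc ρ ε, ∀ t ∈ Ico (0:ℝ) 1, (s * c1 t, s * c2 t) ∈ sector α δ := by
    intro s hs t ht
    have s0 : 0 < s := hρ.trans_le hs.1
    have hsd : s * (a + 1) < δ := (mul_le_mul_of_nonneg_right hs.2 (by linarith)).trans_lt hε
    rcases ht.1.eq_or_lt with h0 | h0
    · have := sector_polar α δ (s * a) θ (by positivity) (by nlinarith) hθ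
      convert this using 2
      · simp only [hc1, ← h0, hA1]; ring
      · simp only [hc2, ← h0, hA2]; ring
    · have := sector_comb α δ θ (s * a * (1 - t)) (s * t) hα hθ hd
        (mul_pos (mul_pos s0 ha) (by linarith [ht.2])) (mul_pos s0 h0) (by
          have : s * a * (1 - t) ≤ s * a := mul_le_of_le_one_right (by positivity) (by linarith)
          have : s * t ≤ s := mul_le_of_le_one_right s0.le ht.2.le
          linarith)
      convert this using 2
      · simp only [hc1, hB1, hA1]; ring
      · simp only [hc2, hB2, hA2]; ring
  have c11 : c1 1 = cos α := by simp only [hc1, hB1]; ring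
  have c21 : c2 1 = sin α := by simp only [hc2, hB2]; ring
  have c10 : c1 0 = A1 := by simp only [hc1]; ring
  have c20 : c2 0 = A2 := by simp only [hc2]; ring
  have reg1 : ∀ s ∈ Icc ρ ε, ∀ t ∈ Icc (0:ℝ) 1, ContDiffAt ℝ 1 f (s * c1 t, s * c2 t) := by
    intro s hs t ht
    rcases ht.2.lt_or_eq with h1 | h1
    · exact (reg _ (mem s hs t ⟨ht.1, h1⟩)).of_le (by norm_num)
    · rw [h1, c11, c21]
      refine edge s ⟨hρ.trans_le hs.1, ?_⟩
      have : s * (a + 1) < δ := (mul_le_mul_of_nonneg_right hs.2 (by linarith)).trans_lt hε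
      have := mul_pos (hρ.trans_le hs.1) ha
      linarith
  have dc1 : ∀ t, HasDerivAt c1 B1 t := fun t =>
    (((hasDerivAt_id t).mul_const B1).const_add A1).congr_deriv (one_mul _)
  have dc2 : ∀ t, HasDerivAt c2 B2 t := fun t =>
    (((hasDerivAt_id t).mul_const B2).const_add A2).congr_deriv (one_mul _)
  have D := (div_cone (fun q => (Tf f q).1) (fun q => (Tf f q).2) h c1 c2 (fun _ => B1) (fun _ => B2)
    (fun _ => 0) (fun _ => 0) dc1 dc2 (fun t => hasDerivAt_const t B1)
    (fun t => hasDerivAt_const t B2) ρ ε 0 1 hρε zero_le_one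
    (fun s hs t ht => (cont_Tf f _ (reg1 s hs t ht)).1)
    (fun s hs t ht => (cont_Tf f _ (reg1 s hs t ht)).2)
    (fun s hs t ht => hc _ (reg1 s hs t ht).continuousAt)
    (fun s hs t ht => by
      have m := mem s (Ioo_subset_Icc_self hs) t (Ioo_subset_Ico_self ht)
      exact ⟨(diff_Tf f _ (reg _ m)).1, (diff_Tf f _ (reg _ m)).2, pde _ m⟩)).2
  have e1 : ‖∫ s in ρ..ε, ∫ t in (0:ℝ)..1, s * (c1 t * B2 - c2 t * B1) *
      h (s * c1 t, s * c2 t)‖ ≤ (ε * (a * C0) * |1 - 0|) * |ε - ρ| := by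
    apply intervalIntegral.norm_integral_le_of_norm_le_const
    intro s hs
    rw [uIoc_of_le hρε] at hs
    apply intervalIntegral.norm_integral_le_of_norm_le_const_ae
    have ne1 : ∀ᵐ t : ℝ, t ≠ 1 := compl_mem_ae_iff.2 (measure_singleton 1)
    filter_upwards [ne1] with t hne ht
    rw [uIoc_of_le zero_le_one] at ht
    have m := hb _ (mem s (Ioc_subset_Icc_self hs) t ⟨ht.1.le, lt_of_le_of_ne ht.2 hne⟩)
    have s0 : 0 < s := hρ.trans hs.1
    rw [det, norm_mul, norm_mul, norm_mul, Real.norm_eq_abs, Real.norm_eq_abs, Real.norm_eq_abs,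
      Real.norm_eq_abs, abs_of_pos s0, abs_of_pos ha, mul_assoc]
    refine mul_le_mul hs.2 ?_ (by positivity) ε0.le
    have : a * |sin (α - θ)| ≤ a := mul_le_of_le_one_right ha.le (abs_sin_le_one _)
    exact mul_le_mul this m (abs_nonneg _) ha.le
  have e2 : ∀ σ : ℝ, 0 < σ → ‖∫ t in (0:ℝ)..1, σ * ((Tf f (σ * c1 t, σ * c2 t)).1 * B2 -
      (Tf f (σ * c1 t, σ * c2 t)).2 * B1)‖ ≤ σ * l * |1 - 0| := by
    intro σ hσ
    apply intervalIntegral.norm_integral_le_of_norm_le_const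
    intro t ht
    rw [norm_mul, Real.norm_eq_abs, Real.norm_eq_abs, abs_of_pos hσ]
    refine mul_le_mul_of_nonneg_left ?_ hσ.le
    have := Tf_dot_le f (σ * c1 t, σ * c2 t) B2 (-B1) l hl0 (by linarith [Bsq])
    have e : ∀ X1 X2 : ℝ, X1 * B2 - X2 * B1 = X1 * B2 + X2 * (-B1) := fun X1 X2 => by ring
    rw [e]
    exact this
  have q1 : (∫ s in ρ..ε, (c1 1 * (Tf f (s * c1 1, s * c2 1)).2 - c2 1 * (Tf f (s * c1 1, s * c2 1)).1))
      = ∫ s in ρ..ε, fluxQ f α s := by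
    rw [c11, c21]; rfl
  have q0 : (∫ s in ρ..ε, (c1 0 * (Tf f (s * c1 0, s * c2 0)).2 - c2 0 * (Tf f (s * c1 0, s * c2 0)).1))
      = ∫ s in (a * ρ)..(a * ε), fluxQ f θ s := by
    rw [c10, c20, ← intervalIntegral.mul_integral_comp_mul_left, ← intervalIntegral.integral_const_mul]
    congr 1
    ext s
    unfold fluxQ
    rw [show a * s * cos θ = s * A1 by rw [hA1]; ring, show a * s * sin θ = s * A2 by rw [hA2]; ring]
    rw [hA1, hA2]
    ring
  rw [q1, q0] at D
  have a1 := e2 ε ε0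
  have a2 := e2 ρ hρ
  rw [sub_zero, abs_one, mul_one, Real.norm_eq_abs] at e1 a1 a2
  rw [abs_of_nonneg (sub_nonneg.2 hρε)] at e1
  have b1 := abs_le.1 e1
  have b2 := abs_le.1 a1
  have b3 := abs_le.1 a2
  linarith [b1.1, b2.2, b3.1]

set_option maxHeartbeats 2000000 in
theorem upper_fan_size_lower_bound
    (α δ κ lam₀ : ℝ) (γp γm : ℝ → ℝ) (f : ℝ × ℝ → ℝ) (R : ℝ → ℝ)
    (hα : α ∈ Ioo 0 π) (hδ : 0 < δ)
    (hsol : IsCapillarySolution α δ κ lam₀ γp γm f)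
    (hdisc : DiscontinuousAtCorner α δ f)
    (hR : ∀ θ ∈ Ioo (-α) α, RadialLimitAt f θ (R θ))
    (α₂ η : ℝ) (hα₂ : α₂ ∈ Ioc (-α) α) (hη : 0 < η)
    (hconst : ∃ c : ℝ, ∀ θ ∈ Ico α₂ α, R θ = c)
    (hmono : StrictMonoOn R (Icc (α₂ - η) α₂ ∩ Ioo (-α) α))
    (m : ℝ) (hm : m ∈ Icc (-1 : ℝ) 1)
    (hAI : ∀ b : ℝ, 0 < b → fanAI γp b ≤ m * b) :
    Real.arccos m ≤ α - α₂ := by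
  obtain ⟨M, hM⟩ := hsol.bounded
  have hopen := sector_isOpen α δ hα
  have reg : ∀ p ∈ sector α δ, ContDiffAt ℝ 2 f p := fun p hp =>
    (hsol.smooth p hp).contDiffAt (hopen.mem_nhds hp)
  set h : ℝ × ℝ → ℝ := fun p => κ * f p + lam₀ with hh
  set C0 := |κ| * M + |lam₀| with hC0
  have hcont : ∀ p, ContinuousAt f p → ContinuousAt h p := fun p hp =>
    (continuousAt_const.mul hp).add continuousAt_const
  have hb : ∀ p ∈ sector α δ, |h p| ≤ C0 := by
    intro p hp
    refine (abs_add_le _ _).trans ?_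
    rw [abs_mul]
    have := mul_le_mul_of_nonneg_left (hM p hp) (abs_nonneg κ)
    linarith
  have pde : ∀ p ∈ sector α δ, Nf f p = h p := hsol.pde
  by_contra hcon
  push Not at hcon
  have hβ0 : 0 ≤ α - α₂ := sub_nonneg.2 hα₂.2
  have hβπ : α - α₂ < π := hcon.trans_le (arccos_le_pi m)
  have hmc : m < cos (α - α₂) := by
    have := strictAntiOn_cos ⟨hβ0, hβπ.le⟩ ⟨arccos_nonneg m, arccos_le_pi m⟩ hcon
    rwa [cos_arccos hm.1 hm.2] at this
  set μ := (cos (α - α₂) - m) / 3 with hμ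
  have μ0 : 0 < μ := by rw [hμ]; linarith
  have μ1 : μ ≤ 2 / 3 := by rw [hμ]; linarith [cos_le_one (α - α₂), hm.1]
  have ev : ∀ᶠ θ in 𝓝 α₂, m + 2 * μ < cos (α - θ) ∧ α - θ < π ∧ -α < θ ∧ α₂ - η < θ := by
    refine Filter.Eventually.and ?_ (Filter.Eventually.and ?_ (Filter.Eventually.and ?_ ?_))
    · have : ContinuousAt (fun θ => cos (α - θ)) α₂ := by fun_prop
      exact this.eventually (lt_mem_nhds (by rw [hμ]; linarith))
    · have : ContinuousAt (fun θ => α - θ) α₂ := by fun_prop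
      exact this.eventually (gt_mem_nhds hβπ)
    · exact lt_mem_nhds hα₂.1
    · exact lt_mem_nhds (by linarith)
  rw [Metric.eventually_nhds_iff] at ev
  obtain ⟨e, e0, he⟩ := ev
  set θ1 := α₂ - e / 2 with hθ1
  set θ2 := α₂ - e / 4 with hθ2
  have h12 : θ1 < θ2 := by rw [hθ1, hθ2]; linarith
  have h2 : θ2 < α := by rw [hθ2]; linarith [hα₂.2]
  have prop : ∀ θ ∈ Icc θ1 θ2, m + 2 * μ < cos (α - θ) ∧ α - θ < π ∧ -α < θ ∧ α₂ - η < θ := by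
    intro θ hθ
    apply he
    have := hθ.1; have := hθ.2
    rw [Real.dist_eq, abs_lt]
    constructor <;> linarith
  have h1 : -α < θ1 := (prop θ1 (left_mem_Icc.2 h12.le)).2.2.1
  have sub : Icc θ1 θ2 ⊆ Icc (α₂ - η) α₂ ∩ Ioo (-α) α := by
    intro θ hθ
    have p := prop θ hθ
    have := hθ.2
    exact ⟨⟨p.2.2.2.le, by linarith⟩, ⟨p.2.2.1, by linarith⟩⟩
  have mono : MonotoneOn R (Icc θ1 θ2) := (hmono.mono sub).monotoneOn
  have hlt : R θ1 < R θ2 :=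
    hmono (sub (left_mem_Icc.2 h12.le)) (sub (right_mem_Icc.2 h12.le)) h12
  have C00 : 0 ≤ C0 := (abs_nonneg _).trans (hb _ (sector_polar α δ (δ / 2) θ1 (by linarith)
    (by linarith) ⟨h1, h12.trans h2⟩))
  set a := 3 + 1 / (2 * μ) with ha
  have a3 : 3 < a := by rw [ha]; have : 0 < 1 / (2 * μ) := by positivity
                        linarith
  have a0 : 0 < a := by linarith
  have aμ : 1 ≤ 2 * a * μ := by
    have : 2 * a * μ = 6 * μ + 1 := by rw [ha]; field_simp; ring
    linarith
  set l := a - m - μ with hl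
  have l0 : 0 ≤ l := by rw [hl]; linarith [hm.2]
  have la : l ≤ a + 1 := by rw [hl]; linarith [hm.1]
  have hl2 : ∀ θ ∈ Icc θ1 θ2, a ^ 2 - 2 * a * cos (α - θ) + 1 ≤ l ^ 2 := by
    intro θ hθ
    have p := mul_le_mul_of_nonneg_left (prop θ hθ).1.le a0.le
    rw [hl]
    nlinarith [sq_nonneg (m + μ)]
  set τ := μ / (4 * a) with hτ
  have τ0 : 0 < τ := by positivity
  have aτ : a * τ = μ / 4 := by rw [hτ]; field_simp
  have EF := exists_flux α δ f h R C0 M hδ reg (fun p hp => hcont p (reg p hp).continuousAt) hb hM pde hR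
    θ1 θ2 h1 h12 h2 mono hlt τ τ0
  have scal : Tendsto (fun ε : ℝ => a * ε) (𝓝[>] 0) (𝓝[>] 0) := by
    refine tendsto_nhdsWithin_iff.2 ⟨?_, ?_⟩
    · have : Tendsto (fun ε : ℝ => a * ε) (𝓝 0) (𝓝 (a * 0)) := (continuous_const.mul continuous_id).tendsto 0
      rw [mul_zero] at this
      exact this.mono_left nhdsWithin_le_nhds
    · filter_upwards [self_mem_nhdsWithin] with ε hε
      exact mul_pos a0 hε
  have EF' := scal.eventually EF
  set C1 := a * l + a * C0 + a with hC1
  have C10 : 0 < C1 := by positivity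
  have i1 : 0 < δ / (a + 1) := by positivity
  have i2 : 0 < μ / (4 * C1) := by positivity
  have i3 : 0 < 1 / a := by positivity
  have final : ∀ᶠ ε in 𝓝[>] (0:ℝ), m + μ / 2 ≤
      ε⁻¹ * ∫ t in Ioo (0:ℝ) (1 * ε), Real.cos (γp t) := by
    filter_upwards [EF', Ioo_mem_nhdsGT i1, Ioo_mem_nhdsGT i2, Ioo_mem_nhdsGT i3] with ε EF h1' h2' h3'
    obtain ⟨θ, hθ, hF⟩ := EF
    have ε0 : 0 < ε := h1'.1
    have aε : a * ε < 1 := by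
      have := h3'.2; rw [lt_div_iff₀ a0] at this; linarith
    have εδ : ε * (a + 1) < δ := by
      have := h1'.2; rwa [lt_div_iff₀ (by positivity)] at this
    have εlt : ε < δ := by linarith only [εδ, mul_pos ε0 a0]
    have ρ0 : 0 < a * ε ^ 2 := by positivity
    have ρε : a * ε ^ 2 ≤ ε := by
      have := mul_le_mul_of_nonneg_left aε.le ε0.le
      linarith only [this]
    have T := triangle_flux α δ f h C0 hα reg hsol.edgeP_smooth hcont hb pde θ a (a * ε ^ 2) ε l
      (sub hθ).2 (prop θ hθ).2.1 a0 ρ0 ρε εδ l0 (hl2 θ hθ)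
    rw [show a * (a * ε ^ 2) = (a * ε) ^ 2 by ring] at T
    have ci : ∀ u v : ℝ, IntervalIntegrable (fun t => Real.cos (γp t)) volume u v := by
      intro u v
      have : IntervalIntegrable (fun _ : ℝ => (1:ℝ)) volume u v := intervalIntegrable_const
      refine this.mono_fun
        ((Real.measurable_cos.comp hsol.measurable_γp).aestronglyMeasurable) ?_
      refine Eventually.of_forall fun t => ?_
      simpa using Real.abs_cos_le_one (γp t)
    have bc : ∫ s in (a * ε ^ 2)..ε, fluxQ f α s = ∫ s in (a * ε ^ 2)..ε, Real.cos (γp s) := by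
      apply intervalIntegral.integral_congr
      intro s hs
      rw [uIcc_of_le ρε] at hs
      have s0 := ρ0.trans_le hs.1
      have := hsol.bcP s ⟨s0, lt_of_le_of_lt hs.2 εlt⟩
      simp only
      rw [← this]
      unfold fluxQ dot
      ring
    have low : ‖∫ s in (0:ℝ)..(a * ε ^ 2), Real.cos (γp s)‖ ≤ 1 * |a * ε ^ 2 - 0| := by
      apply intervalIntegral.norm_integral_le_of_norm_le_const
      intro t _
      exact Real.abs_cos_le_one (γp t)
    rw [Real.norm_eq_abs, sub_zero, abs_of_pos ρ0] at low
    have low' := (abs_le.1 low).1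
    have add := intervalIntegral.integral_add_adjacent_intervals (ci 0 (a * ε ^ 2)) (ci (a * ε ^ 2) ε)
    rw [one_mul, ← integral_Ioc_eq_integral_Ioo, ← intervalIntegral.integral_of_le ε0.le, ← add]
    rw [bc] at T
    have c1 : C1 * ε ≤ μ / 4 := by
      have := h2'.2.le; rw [le_div_iff₀ (by positivity)] at this; linarith only [this]
    have c2 : ε * (C1 * ε) ≤ ε * (μ / 4) := mul_le_mul_of_nonneg_left c1 ε0.le
    have c3 : ε * (ε - a * ε ^ 2) * (a * C0) ≤ ε ^ 2 * (a * C0) := by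
      apply mul_le_mul_of_nonneg_right _ (by positivity)
      have := mul_pos ε0 ρ0
      linarith only [this]
    have c4 : (1 - τ) * (a * ε) = a * ε - (μ / 4) * ε := by
      linear_combination (-ε) * aτ
    have c5 : (ε + a * ε ^ 2) * l = (a - m - μ) * ε + a * l * ε ^ 2 := by rw [hl]; ring
    rw [c4] at hF
    rw [c5] at T
    have c6 : ε * (C1 * ε) = a * l * ε ^ 2 + ε ^ 2 * (a * C0) + a * ε ^ 2 := by rw [hC1]; ring
    rw [inv_mul_eq_div, le_div_iff₀ ε0]
    linarith only [T, hF, c2, c3, c6, low']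
  have cob : (𝓝[>] (0:ℝ)).IsCoboundedUnder (· ≥ ·)
      (fun ε : ℝ => ε⁻¹ * ∫ t in Ioo (0:ℝ) (1 * ε), Real.cos (γp t)) := by
    refine isCoboundedUnder_ge_of_eventually_le (x := 1) _ ?_
    filter_upwards [self_mem_nhdsWithin] with ε hε
    have hε' : (0:ℝ) < ε := hε
    rw [one_mul, ← integral_Ioc_eq_integral_Ioo, ← intervalIntegral.integral_of_le hε'.le]
    have low : ‖∫ s in (0:ℝ)..ε, Real.cos (γp s)‖ ≤ 1 * |ε - 0| := by
      apply intervalIntegral.norm_integral_le_of_norm_le_const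
      intro t _
      exact Real.abs_cos_le_one (γp t)
    rw [Real.norm_eq_abs, sub_zero, abs_of_pos hε', one_mul] at low
    rw [inv_mul_eq_div, div_le_one hε']
    exact (abs_le.1 low).2
  have lim := le_liminf_of_le cob final
  have := hAI 1 one_pos
  unfold fanAI at this
  linarith
end
end

section
/- Let β ∈ [0, π), σ ∈ (0, π), and set m = cos σ. Suppose that for every λ ∈ (β, π) one has sin λ + m·sin(λ − β) ≤ sin β. Then β ≥ π − σ. -/
open Real Set

/-- If `β ∈ [0, π)`, `σ ∈ (0, π)`, `m = cos σ`, and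
`sin λ + m·sin(λ − β) ≤ sin β` for every `λ ∈ (β, π)`, then `β ≥ π − σ`. -/
theorem fan_trig_inequality_decreasing (β σ : ℝ)
    (hβ : β ∈ Ico 0 π) (hσ : σ ∈ Ioo 0 π)
    (h : ∀ lam ∈ Ioo β π,
      Real.sin lam + Real.cos σ * Real.sin (lam - β) ≤ Real.sin β) :
    π - σ ≤ β := by
  by_contra hc
  have hc : β < π - σ := not_le.mp hc
  obtain ⟨hb0, hb1⟩ := hβ
  obtain ⟨hs0, hs1⟩ := hσ
  have h1 := h (π - σ) ⟨hc, by linarith⟩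
  have e1 : Real.sin (π - σ - β) = Real.sin (σ + β) := by
    rw [← Real.sin_pi_sub (σ + β)]
    congr 1
    ring
  have e2 : Real.sin β = Real.sin (σ + β) * Real.cos σ - Real.cos (σ + β) * Real.sin σ := by
    rw [← Real.sin_sub]
    congr 1
    ring
  rw [e1, Real.sin_pi_sub, e2] at h1
  have hsin : 0 < Real.sin σ := Real.sin_pos_of_pos_of_lt_pi hs0 hs1
  have hcos : Real.cos π < Real.cos (σ + β) :=
    Real.cos_lt_cos_of_nonneg_of_le_pi (by linarith) le_rfl (by linarith)
  rw [Real.cos_pi] at hcos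
  have := mul_pos hsin (show 0 < 1 + Real.cos (σ + β) by linarith)
  nlinarith
end

section
/- Let γ : (0, 1) → [0, π] be measurable and let b ∈ (0, 1). Then there exist a strictly decreasing sequence (ε_k) of positive numbers with ε_k → 0 and a measurable function γ* : (0, 1) → [0, π] such that (1) for every m ∈ L¹((0,1)), ∫₀¹ cos(γ(ε_k s)) m(s) ds → ∫₀¹ cos(γ*(s)) m(s) ds as k → ∞ (that is, cos(γ(ε_k ·)) converges weak-star to cos(γ*) in L^∞((0,1)) = (L¹((0,1)))*), and (2) ∫₀^{b} cos(γ*(s)) ds = liminf_{ε→0⁺} (1/ε) ∫₀^{bε} cos(γ(t)) dt. -/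
open Real Set Filter MeasureTheory Topology

lemma aux_compact {μ : Measure ℝ} [IsFiniteMeasure μ]
    (f : ℕ → ℝ → ℝ) (hf : ∀ k, Measurable (f k)) (hb : ∀ k s, |f k s| ≤ 1) :
    ∃ φ : ℕ → ℕ, StrictMono φ ∧ ∃ g : ℝ → ℝ, Measurable g ∧ (∀ᵐ s ∂μ, |g s| ≤ 1) ∧
      ∀ h : ℝ → ℝ, MemLp h 2 μ →
        Tendsto (fun k => ∫ s, f (φ k) s * h s ∂μ) atTop (𝓝 (∫ s, g s * h s ∂μ)) := by
  have hL : ∀ k, MemLp (f k) 2 μ := fun k =>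
    MemLp.of_bound (hf k).aestronglyMeasurable 1 (ae_of_all _ fun s => hb k s)
  have : Fact ((1:ENNReal) ≤ 2) := ⟨by norm_num⟩
  have : Fact ((2:ENNReal) ≠ ⊤) := ⟨by norm_num⟩
  let H := Lp ℝ 2 μ
  let F : ℕ → H := fun k => (hL k).toLp (f k)
  obtain ⟨R, hR⟩ : ∃ R : ℝ, ∀ k, ‖F k‖ ≤ R := by
    refine ⟨_, fun k => Lp.norm_le_of_ae_bound (C := 1) zero_le_one ?_⟩
    filter_upwards [(hL k).coeFn_toLp] with s hs
    show ‖((hL k).toLp (f k)) s‖ ≤ 1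
    rw [hs]; exact hb k s
  let D : ℕ → WeakDual ℝ H := fun k => StrongDual.toWeakDual (InnerProductSpace.toDual ℝ H (F k))
  obtain ⟨d, -, φ, hφ, hd⟩ := WeakDual.isSeqCompact_closedBall ℝ H (0 : StrongDual ℝ H) R
    (x := D) (fun k => by
      simp only [mem_preimage, mem_closedBall_zero_iff]
      show ‖InnerProductSpace.toDual ℝ H (F k)‖ ≤ R
      simpa using hR k)
  let G : H := (InnerProductSpace.toDual ℝ H).symm (WeakDual.toStrongDual d)
  have hGm := (Lp.aestronglyMeasurable G).aemeasurable
  have key : ∀ h : ℝ → ℝ, MemLp h 2 μ →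
        Tendsto (fun k => ∫ s, f (φ k) s * h s ∂μ) atTop (𝓝 (∫ s, hGm.mk _ s * h s ∂μ)) := by
    intro h hh
    have h1 := (WeakDual.eval_continuous (𝕜 := ℝ) (E := H) (hh.toLp h)).continuousAt.tendsto.comp hd
    convert h1 using 1
    · funext k
      show _ = inner ℝ (F (φ k)) (hh.toLp h)
      rw [L2.inner_def]
      apply integral_congr_ae
      filter_upwards [hh.coeFn_toLp, (hL (φ k)).coeFn_toLp] with s h1 h2
      show _ = inner ℝ (((hL (φ k)).toLp _) s) _
      rw [h1, h2]; simp [mul_comm]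
    · congr 1
      have : d (hh.toLp h) = inner ℝ G (hh.toLp h) := by
        simp only [G, InnerProductSpace.toDual_symm_apply]; rfl
      show _ = d (hh.toLp h)
      rw [this, L2.inner_def]
      apply integral_congr_ae
      filter_upwards [hh.coeFn_toLp, hGm.ae_eq_mk] with s h1 h2
      rw [h1, ← h2]; simp [mul_comm]
  have hgL : MemLp (hGm.mk _) 2 μ := (memLp_congr_ae hGm.ae_eq_mk).1 (Lp.memLp G)
  have hgi : Integrable (hGm.mk _) μ := hgL.integrable (by norm_num)
  have hset : ∀ A : Set ℝ, MeasurableSet A →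
      |∫ s in A, hGm.mk _ s ∂μ| ≤ μ.real A := by
    intro A hA
    have h1 := key (A.indicator 1) ((memLp_const (1:ℝ)).indicator hA)
    have e : ∀ u : ℝ → ℝ, ∫ s, u s * A.indicator 1 s ∂μ = ∫ s in A, u s ∂μ := by
      intro u
      rw [← integral_indicator hA]
      congr 1; funext s
      by_cases hs : s ∈ A <;> simp [hs]
    simp only [e] at h1
    refine le_of_tendsto h1.abs (Eventually.of_forall fun k => ?_)
    have := norm_setIntegral_le_of_norm_le_const (μ := μ) (s := A) (f := f (φ k)) (C := 1)
      (measure_lt_top _ _) (fun s _ => hb _ s)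
    simpa using this
  refine ⟨φ, hφ, hGm.mk _, hGm.measurable_mk, ?_, key⟩
  have u1 : hGm.mk _ ≤ᵐ[μ] fun _ => (1:ℝ) := by
    refine ae_le_of_forall_setIntegral_le hgi (integrable_const _) fun A hA _ => ?_
    simpa using (abs_le.1 (hset A hA)).2
  have u2 : (fun _ => (-1:ℝ)) ≤ᵐ[μ] hGm.mk _ := by
    refine ae_le_of_forall_setIntegral_le (integrable_const _) hgi fun A hA _ => ?_
    simpa using (abs_le.1 (hset A hA)).1
  filter_upwards [u1, u2] with s h1 h2
  exact abs_le.2 ⟨h2, h1⟩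

lemma aux_L1 {μ : Measure ℝ} [IsFiniteMeasure μ]
    (f : ℕ → ℝ → ℝ) (hf : ∀ k, Measurable (f k)) (hb : ∀ k s, |f k s| ≤ 1)
    (g : ℝ → ℝ) (hg : Measurable g) (hgb : ∀ s, |g s| ≤ 1)
    (H : ∀ h : ℝ → ℝ, MemLp h 2 μ →
        Tendsto (fun k => ∫ s, f k s * h s ∂μ) atTop (𝓝 (∫ s, g s * h s ∂μ)))
    (m : ℝ → ℝ) (hm : Integrable m μ) :
    Tendsto (fun k => ∫ s, f k s * m s ∂μ) atTop (𝓝 (∫ s, g s * m s ∂μ)) := by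
  rw [Metric.tendsto_atTop]
  intro η hη
  obtain ⟨h, hh1, hh2⟩ := (memLp_one_iff_integrable.2 hm).exists_simpleFunc_eLpNorm_sub_lt
    (by norm_num) (ε := ENNReal.ofReal (η/3)) (by simpa using by positivity)
  have hhi : Integrable h μ := memLp_one_iff_integrable.1 hh2
  have hd : ∫ s, |m s - h s| ∂μ < η / 3 := by
    have h0 := integral_norm_eq_lintegral_enorm (hm.sub hhi).aestronglyMeasurable
    rw [eLpNorm_one_eq_lintegral_enorm] at hh1
    have := ENNReal.toReal_lt_of_lt_ofReal hh1
    rw [← h0] at this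
    simpa using this
  have cmp : ∀ u : ℝ → ℝ, Measurable u → (∀ s, |u s| ≤ 1) →
      |∫ s, u s * m s ∂μ - ∫ s, u s * h s ∂μ| < η / 3 := by
    intro u hu hub
    have i1 : Integrable (fun s => u s * m s) μ :=
      hm.bdd_mul hu.aestronglyMeasurable (ae_of_all _ hub)
    have i2 : Integrable (fun s => u s * h s) μ :=
      hhi.bdd_mul hu.aestronglyMeasurable (ae_of_all _ hub)
    rw [← integral_sub i1 i2]
    refine lt_of_le_of_lt (abs_integral_le_integral_abs) (lt_of_le_of_lt ?_ hd)
    refine integral_mono (i1.sub i2).abs (hm.sub hhi).abs fun s => ?_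
    show |u s * m s - u s * h s| ≤ |m s - h s|
    rw [← mul_sub, abs_mul]
    exact mul_le_of_le_one_left (abs_nonneg _) (hub s)
  obtain ⟨N, hN⟩ := Metric.tendsto_atTop.1 (H h (h.memLp_of_isFiniteMeasure 2 μ)) (η/3) (by positivity)
  refine ⟨N, fun n hn => ?_⟩
  have a1 := abs_lt.1 (cmp _ (hf n) (hb n))
  have a2 := abs_lt.1 (cmp _ hg hgb)
  have a3 := hN n hn
  rw [Real.dist_eq] at a3 ⊢
  have a3 := abs_lt.1 a3
  rw [abs_lt]; constructor <;> linarith [a1.1, a1.2, a2.1, a2.2, a3.1, a3.2]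

lemma aux_scale (c : ℝ → ℝ) (b e : ℝ) (hb : 0 < b) (he : 0 < e) :
    e⁻¹ * ∫ t in Ioo (0:ℝ) (b * e), c t = ∫ s in Ioo (0:ℝ) b, c (e * s) := by
  rw [← integral_Ioc_eq_integral_Ioo, ← integral_Ioc_eq_integral_Ioo,
    ← intervalIntegral.integral_of_le (by positivity), ← intervalIntegral.integral_of_le hb.le,
    intervalIntegral.integral_comp_mul_left _ he.ne']
  simp [mul_comm]

lemma aux_seq (F : ℝ → ℝ) (C : ℝ) (hF : ∀ e, 0 < e → |F e| ≤ C) :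
    ∃ ε : ℕ → ℝ, StrictAnti ε ∧ (∀ k, 0 < ε k) ∧ Tendsto ε atTop (𝓝 0) ∧
      Tendsto (fun k => F (ε k)) atTop (𝓝 (liminf F (𝓝[>] (0:ℝ)))) := by
  set L := liminf F (𝓝[>] (0:ℝ)) with hL
  have ev : ∀ᶠ e in 𝓝[>] (0:ℝ), |F e| ≤ C := by
    filter_upwards [self_mem_nhdsWithin] with e he using hF e he
  have bb : IsBoundedUnder (· ≥ ·) (𝓝[>] (0:ℝ)) F :=
    ⟨-C, by simpa using ev.mono fun e he => (abs_le.1 he).1⟩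
  have ba : IsBoundedUnder (· ≤ ·) (𝓝[>] (0:ℝ)) F :=
    ⟨C, by simpa using ev.mono fun e he => (abs_le.1 he).2⟩
  have hc : MapClusterPt L (𝓝[>] (0:ℝ)) F := by
    rw [mapClusterPt_iff_frequently]
    intro s hs
    obtain ⟨δ, hδ, hs⟩ := Metric.mem_nhds_iff.1 hs
    have h1 := frequently_lt_of_liminf_lt ba.isCoboundedUnder_ge
      (show liminf F (𝓝[>] (0:ℝ)) < L + δ by linarith)
    have h2 := eventually_lt_of_lt_liminf (show L - δ < liminf F (𝓝[>] (0:ℝ)) by linarith) bb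
    refine (h1.and_eventually h2).mono fun e he => hs ?_
    rw [Metric.mem_ball, Real.dist_eq, abs_lt]
    constructor <;> linarith [he.1, he.2]
  have hne : NeBot (𝓝[>] (0:ℝ) ⊓ comap F (𝓝 L)) := by
    rw [inf_comm, ← Filter.map_neBot_iff F]
    have : map F (comap F (𝓝 L) ⊓ 𝓝[>] (0:ℝ)) = 𝓝 L ⊓ map F (𝓝[>] (0:ℝ)) := by
      rw [inf_comm, Filter.push_pull, inf_comm]
    rw [this]; exact hc
  obtain ⟨x, hx⟩ := exists_seq_tendsto (𝓝[>] (0:ℝ) ⊓ comap F (𝓝 L))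
  obtain ⟨hx1, hx2⟩ := tendsto_inf.1 hx
  rw [tendsto_comap_iff] at hx2
  obtain ⟨N, hN⟩ := eventually_atTop.1 (hx1.eventually self_mem_nhdsWithin)
  have hx1' := hx1.comp (tendsto_add_atTop_nat N)
  have hx2' := hx2.comp (tendsto_add_atTop_nat N)
  obtain ⟨φ, hφ, hφ2⟩ := strictMono_subseq_of_tendsto_atTop (tendsto_inv_nhdsGT_zero.comp hx1')
  have pos : ∀ k, 0 < x (φ k + N) := fun k => hN _ (by omega)
  refine ⟨fun k => x (φ k + N), ?_, pos, ?_, hx2'.comp hφ.tendsto_atTop⟩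
  · intro i j hij
    exact (inv_lt_inv₀ (pos i) (pos j)).1 (hφ2 hij)
  · exact (hx1'.comp hφ.tendsto_atTop).mono_right nhdsWithin_le_nhds

/-- For measurable `γ : (0,1) → [0,π]` and `b ∈ (0,1)` there are a strictly
decreasing sequence `ε_k ↓ 0` of positive numbers and a measurable `γ* : (0,1) → [0,π]` such
that `cos(γ(ε_k ·)) → cos(γ*)` weak-star in `L^∞((0,1)) = (L¹((0,1)))*` (i.e. tested against
every `m ∈ L¹((0,1))`), and `∫₀^b cos(γ*(s)) ds = liminf_{ε→0⁺} (1/ε) ∫₀^{bε} cos(γ(t)) dt`. -/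
theorem weak_star_limit_attains_liminf
    (γ : ℝ → ℝ) (hmeas : Measurable γ)
    (hrange : ∀ t ∈ Ioo (0:ℝ) 1, γ t ∈ Icc 0 π)
    (b : ℝ) (hb : b ∈ Ioo (0:ℝ) 1) :
    ∃ ε : ℕ → ℝ, StrictAnti ε ∧ (∀ k, 0 < ε k) ∧ Tendsto ε atTop (𝓝 0) ∧
      ∃ γs : ℝ → ℝ, Measurable γs ∧ (∀ s ∈ Ioo (0:ℝ) 1, γs s ∈ Icc 0 π) ∧
        (∀ m : ℝ → ℝ, IntegrableOn m (Ioo (0:ℝ) 1) →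
          Tendsto (fun k : ℕ => ∫ s in Ioo (0:ℝ) 1, Real.cos (γ (ε k * s)) * m s) atTop
            (𝓝 (∫ s in Ioo (0:ℝ) 1, Real.cos (γs s) * m s))) ∧
        (∫ s in Ioo (0:ℝ) b, Real.cos (γs s)) =
          liminf (fun e : ℝ => e⁻¹ * ∫ t in Ioo (0:ℝ) (b * e), Real.cos (γ t))
            (𝓝[>] (0:ℝ)) := by
  obtain ⟨ε, hε1, hε2, hε3, hε4⟩ := aux_seq
    (fun e : ℝ => e⁻¹ * ∫ t in Ioo (0:ℝ) (b * e), Real.cos (γ t)) b (fun e he => by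
      rw [aux_scale (fun t => Real.cos (γ t)) b e hb.1 he]
      have := norm_setIntegral_le_of_norm_le_const (μ := volume) (s := Ioo (0:ℝ) b)
        (f := fun s => Real.cos (γ (e * s))) (C := 1)
        (by simp) (fun s _ => Real.abs_cos_le_one _)
      simpa [hb.1.le] using this)
  have hfm : ∀ k, Measurable fun s => Real.cos (γ (ε k * s)) := fun k =>
    Real.measurable_cos.comp (hmeas.comp (measurable_const_mul _))
  obtain ⟨φ, hφ, g, hg, hgb, hlim⟩ := aux_compact (μ := volume.restrict (Ioo (0:ℝ) 1))
    (fun k s => Real.cos (γ (ε k * s))) hfm (fun k s => Real.abs_cos_le_one _)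
  have hcm : Measurable fun s => Real.arccos (g s) := Real.measurable_arccos.comp hg
  have hweak := aux_L1 (μ := volume.restrict (Ioo (0:ℝ) 1))
    (fun k s => Real.cos (γ (ε (φ k) * s))) (fun k => hfm _) (fun k s => Real.abs_cos_le_one _)
    (fun s => Real.cos (Real.arccos (g s))) (Real.measurable_cos.comp hcm)
    (fun s => Real.abs_cos_le_one _) (fun h hh => by
      have e : ∫ s in Ioo (0:ℝ) 1, Real.cos (Real.arccos (g s)) * h s
          = ∫ s in Ioo (0:ℝ) 1, g s * h s := by
        apply integral_congr_ae
        filter_upwards [hgb] with s hs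
        rw [Real.cos_arccos (abs_le.1 hs).1 (abs_le.1 hs).2]
      rw [e]; exact hlim h hh)
  refine ⟨ε ∘ φ, hε1.comp_strictMono hφ, fun k => hε2 _, hε3.comp hφ.tendsto_atTop,
    fun s => Real.arccos (g s), hcm, fun s _ => ⟨Real.arccos_nonneg _, Real.arccos_le_pi _⟩,
    hweak, ?_⟩
  have h1 := hweak ((Ioo (0:ℝ) b).indicator 1)
    ((integrable_const (1:ℝ)).indicator measurableSet_Ioo)
  have e : ∀ u : ℝ → ℝ, ∫ s in Ioo (0:ℝ) 1, u s * (Ioo (0:ℝ) b).indicator 1 s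
      = ∫ s in Ioo (0:ℝ) b, u s := by
    intro u
    have : (fun s => u s * (Ioo (0:ℝ) b).indicator 1 s) = (Ioo (0:ℝ) b).indicator u := by
      funext s
      by_cases hs : s ∈ Ioo (0:ℝ) b <;> simp [indicator, hs]
    rw [this, setIntegral_indicator measurableSet_Ioo,
      inter_eq_self_of_subset_right (Ioo_subset_Ioo_right hb.2.le)]
  simp only [e] at h1
  refine tendsto_nhds_unique h1 ?_
  refine (hε4.comp hφ.tendsto_atTop).congr fun k => ?_
  exact aux_scale (fun t => Real.cos (γ t)) b _ hb.1 (hε2 _)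
end

section
/- Let 0 ≤ γ₁ ≤ γ₂ ≤ π and define γ : (0, 1] → [0, π] by γ(s) = γ₁ if s ∈ (2^{−n²}, 2^{−n(n−1)}] for some integer n ≥ 1, and γ(s) = γ₂ if s ∈ (2^{−n(n+1)}, 2^{−n²}] for some integer n ≥ 1 (these intervals partition (0, 1]). Then for every b ∈ (0, 1), liminf_{ε→0⁺} (1/ε) ∫₀^{bε} cos(γ(t)) dt = b·cos(γ₂). -/
open Real Set Filter MeasureTheory Topology
open scoped Classical

/-- The contact angle of Example 1: `γ₁` on each interval `(2^{−n²}, 2^{−n(n−1)}]` and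
`γ₂` elsewhere (in particular on each interval `(2^{−n(n+1)}, 2^{−n²}]`); these two
families of intervals partition `(0,1]`. -/
noncomputable def gammaEx1 (γ₁ γ₂ : ℝ) (s : ℝ) : ℝ :=
  if ∃ n : ℕ, 1 ≤ n ∧
      s ∈ Ioc ((2:ℝ) ^ (-((n:ℤ) ^ 2))) ((2:ℝ) ^ (-((n:ℤ) * ((n:ℤ) - 1))))
  then γ₁ else γ₂

lemma aux_meas (γ₁ γ₂ : ℝ) : Measurable (fun t => Real.cos (gammaEx1 γ₁ γ₂ t)) := by
  apply Real.measurable_cos.comp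
  unfold gammaEx1
  refine Measurable.ite ?_ measurable_const measurable_const
  have : {s : ℝ | ∃ n : ℕ, 1 ≤ n ∧
      s ∈ Ioc ((2:ℝ) ^ (-((n:ℤ) ^ 2))) ((2:ℝ) ^ (-((n:ℤ) * ((n:ℤ) - 1))))} =
      ⋃ n : ℕ, ⋃ _ : 1 ≤ n, Ioc ((2:ℝ) ^ (-((n:ℤ) ^ 2))) ((2:ℝ) ^ (-((n:ℤ) * ((n:ℤ) - 1)))) := by
    ext s; simp only [mem_setOf_eq, mem_iUnion, exists_prop]
  rw [this]
  exact MeasurableSet.iUnion fun n => MeasurableSet.iUnion fun _ => measurableSet_Ioc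

lemma aux_int (γ₁ γ₂ x : ℝ) :
    IntegrableOn (fun t => Real.cos (gammaEx1 γ₁ γ₂ t)) (Ioo 0 x) := by
  refine Measure.integrableOn_of_bounded (M := 1) (by simp)
    (aux_meas γ₁ γ₂).aestronglyMeasurable ?_
  exact Eventually.of_forall fun t => by
    rw [Real.norm_eq_abs]; exact Real.abs_cos_le_one _

lemma aux_lower (γ₁ γ₂ : ℝ) (h₁ : 0 ≤ γ₁) (h₁₂ : γ₁ ≤ γ₂) (h₂ : γ₂ ≤ π) (t : ℝ) :
    Real.cos γ₂ ≤ Real.cos (gammaEx1 γ₁ γ₂ t) := by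
  unfold gammaEx1
  split_ifs
  · exact Real.cos_le_cos_of_nonneg_of_le_pi h₁ h₂ h₁₂
  · exact le_rfl

lemma aux_eq (γ₁ γ₂ : ℝ) (n : ℕ) (t : ℝ) (h1 : (2:ℝ) ^ (-((n:ℤ) * ((n:ℤ) + 1))) < t)
    (h2 : t ≤ (2:ℝ) ^ (-((n:ℤ) ^ 2))) : gammaEx1 γ₁ γ₂ t = γ₂ := by
  unfold gammaEx1
  rw [if_neg]
  rintro ⟨m, hm, h3, h4⟩
  have h5 := (zpow_lt_zpow_iff_right₀ (one_lt_two (α := ℝ))).1 (h3.trans_le h2)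
  have h6 := (zpow_lt_zpow_iff_right₀ (one_lt_two (α := ℝ))).1 (h1.trans_le h4)
  have h7 : (n:ℤ) < m := by
    by_contra! h
    have : (0:ℤ) ≤ m := by positivity
    nlinarith
  have : (0:ℤ) ≤ n := by positivity
  nlinarith

lemma aux_upper (γ₁ γ₂ : ℝ) (n : ℕ) :
    ∫ t in Ioo (0:ℝ) ((2:ℝ) ^ (-((n:ℤ) ^ 2))), Real.cos (gammaEx1 γ₁ γ₂ t) ≤
      (2:ℝ) ^ (-((n:ℤ) ^ 2)) * Real.cos γ₂ + 2 * (2:ℝ) ^ (-((n:ℤ) * ((n:ℤ) + 1))) := by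
  set x := (2:ℝ) ^ (-((n:ℤ) ^ 2)) with hx
  set y := (2:ℝ) ^ (-((n:ℤ) * ((n:ℤ) + 1))) with hy
  have hx0 : 0 < x := by positivity
  have hy0 : 0 < y := by positivity
  have hi : IntegrableOn ((Iic y).indicator (fun _ => (2:ℝ))) (Ioo 0 x) :=
    (integrableOn_const (by simp)).indicator measurableSet_Iic
  have hc : IntegrableOn (fun _ : ℝ => Real.cos γ₂) (Ioo 0 x) := integrableOn_const (by simp)
  calc _ ≤ ∫ t in Ioo (0:ℝ) x, (Real.cos γ₂ + (Iic y).indicator (fun _ => (2:ℝ)) t) := by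
        refine setIntegral_mono_on (aux_int _ _ _) (hc.add hi) measurableSet_Ioo ?_
        intro t ht
        by_cases h : t ≤ y
        · rw [indicator_of_mem (by exact h)]
          linarith [Real.cos_le_one (gammaEx1 γ₁ γ₂ t), Real.neg_one_le_cos γ₂]
        · rw [indicator_of_notMem (by exact h), aux_eq γ₁ γ₂ n t (not_le.1 h) ht.2.le]
          simp
    _ = x * Real.cos γ₂ + ∫ t in Ioo (0:ℝ) x, (Iic y).indicator (fun _ => (2:ℝ)) t := by
        rw [integral_add hc hi]
        simp [hx0.le]
    _ ≤ _ := by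
        gcongr
        rw [setIntegral_indicator measurableSet_Iic]
        have : volume.real (Ioo 0 x ∩ Iic y) ≤ volume.real (Ioc 0 y) :=
          measureReal_mono (fun t ht => ⟨ht.1.1, ht.2⟩) (by simp)
        simp only [Real.volume_real_Ioc_of_le hy0.le] at this
        simp only [setIntegral_const, smul_eq_mul]
        linarith

/-- For the contact angle of Example 1 and any `b ∈ (0,1)`,
`liminf_{ε→0⁺} (1/ε) ∫₀^{bε} cos(γ(t)) dt = b·cos γ₂`. -/
theorem example1_liminf (γ₁ γ₂ : ℝ) (h₁ : 0 ≤ γ₁) (h₁₂ : γ₁ ≤ γ₂) (h₂ : γ₂ ≤ π)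
    (b : ℝ) (hb : b ∈ Ioo (0:ℝ) 1) :
    liminf (fun ε : ℝ => ε⁻¹ * ∫ t in Ioo (0:ℝ) (b * ε), Real.cos (gammaEx1 γ₁ γ₂ t))
        (𝓝[>] (0:ℝ)) = b * Real.cos γ₂ := by
  obtain ⟨hb0, hb1⟩ := hb
  have hlow : ∀ᶠ ε in 𝓝[>] (0:ℝ), b * Real.cos γ₂ ≤
      ε⁻¹ * ∫ t in Ioo (0:ℝ) (b * ε), Real.cos (gammaEx1 γ₁ γ₂ t) := by
    filter_upwards [self_mem_nhdsWithin] with ε hε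
    have hε : 0 < ε := hε
    have h : ∫ t in Ioo (0:ℝ) (b * ε), Real.cos γ₂ ≤
        ∫ t in Ioo (0:ℝ) (b * ε), Real.cos (gammaEx1 γ₁ γ₂ t) :=
      setIntegral_mono_on (integrableOn_const (by simp)) (aux_int _ _ _) measurableSet_Ioo
        fun t _ => aux_lower _ _ h₁ h₁₂ h₂ t
    rw [setIntegral_const, Real.volume_real_Ioo_of_le (by positivity), smul_eq_mul] at h
    calc b * Real.cos γ₂ = ε⁻¹ * ((b * ε - 0) * Real.cos γ₂) := by field_simp; ring
      _ ≤ _ := by gcongr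
  have hfreq : ∀ δ > 0, ∃ᶠ ε in 𝓝[>] (0:ℝ),
      ε⁻¹ * ∫ t in Ioo (0:ℝ) (b * ε), Real.cos (gammaEx1 γ₁ γ₂ t) ≤ b * Real.cos γ₂ + δ := by
    intro δ hδ
    have hhalf : Tendsto (fun n : ℕ => ((1:ℝ)/2) ^ n) atTop (𝓝 0) :=
      tendsto_pow_atTop_nhds_zero_of_lt_one (by norm_num) (by norm_num)
    have hle : ∀ n : ℕ, (2:ℝ) ^ (-((n:ℤ) ^ 2)) ≤ (1/2) ^ n := by
      intro n
      rw [one_div, inv_pow, zpow_neg]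
      have : (2:ℝ) ^ ((n:ℤ) ^ 2) = 2 ^ (n ^ 2) := by exact_mod_cast zpow_natCast (2:ℝ) (n ^ 2)
      rw [this]
      gcongr
      · norm_num
      · nlinarith [Nat.le_self_pow two_ne_zero n]
    have hs : Tendsto (fun n : ℕ => (2:ℝ) ^ (-((n:ℤ) ^ 2)) / b) atTop (𝓝[>] (0:ℝ)) := by
      refine tendsto_nhdsWithin_iff.2 ⟨?_, Eventually.of_forall fun n => ?_⟩
      · have := squeeze_zero (fun n : ℕ => by positivity) hle hhalf
        simpa using this.div_const b
      · rw [mem_Ioi]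
        positivity
    have hev : ∀ᶠ n : ℕ in atTop, 2 * b * ((1:ℝ)/2) ^ n ≤ δ := by
      have := hhalf.const_mul (2 * b)
      rw [mul_zero] at this
      exact this.eventually_le_const hδ
    refine hs.frequently (Eventually.frequently ?_)
    filter_upwards [hev] with n hn
    have hup := aux_upper γ₁ γ₂ n
    have hy : (2:ℝ) ^ (-((n:ℤ) * ((n:ℤ) + 1))) = 2 ^ (-((n:ℤ) ^ 2)) * (1/2) ^ n := by
      rw [show -((n:ℤ) * ((n:ℤ) + 1)) = -((n:ℤ)^2) + -(n:ℤ) by ring,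
        zpow_add₀ two_ne_zero, zpow_neg _ (n:ℤ), zpow_natCast, one_div, inv_pow]
    rw [hy] at hup
    have hx0 : (0:ℝ) < (2:ℝ) ^ (-((n:ℤ) ^ 2)) := by positivity
    generalize (2:ℝ) ^ (-((n:ℤ) ^ 2)) = x at *
    rw [mul_div_cancel₀ _ hb0.ne']
    calc _ ≤ (x / b)⁻¹ * (x * Real.cos γ₂ + 2 * (x * (1/2) ^ n)) := by gcongr
      _ = b * Real.cos γ₂ + 2 * b * (1/2) ^ n := by field_simp
      _ ≤ _ := by linarith
  apply le_antisymm
  · refine le_of_forall_pos_le_add fun δ hδ => ?_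
    exact liminf_le_of_frequently_le (hfreq δ hδ) ⟨_, hlow⟩
  · exact le_liminf_of_le (IsCoboundedUnder.of_frequently_le (hfreq 1 one_pos)) hlow
end

section
/- Let 0 ≤ γ₁ ≤ γ₂ ≤ π and define γ : (0, 1) → [0, π] by: γ(s) = γ₁ if s ∈ (2·4^{−n}, 4·4^{−n}) for some integer n ≥ 1, γ(s) = γ₂ if s ∈ (4^{−n}, 2·4^{−n}) for some integer n ≥ 1, γ(4·4^{−n}) = π and γ(2·4^{−n}) = 0 for every integer n ≥ 1. Then for every b ∈ (0, 1), liminf_{ε→0⁺} (1/ε) ∫₀^{bε} cos(γ(t)) dt = b·((1/3)·cos(γ₁) + (2/3)·cos(γ₂)). -/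
open Real Set Filter MeasureTheory Topology
open scoped Classical

/-- The contact angle of Example 2: `π` at the points `4·4^{−n}`, `0` at the points
`2·4^{−n}`, `γ₁` on each open interval `(2·4^{−n}, 4·4^{−n})`, and `γ₂` elsewhere
(in particular on each open interval `(4^{−n}, 2·4^{−n})`), for `n = 1, 2, 3, …`. -/
noncomputable def gammaEx2 (γ₁ γ₂ : ℝ) (s : ℝ) : ℝ :=
  if ∃ n : ℕ, 1 ≤ n ∧ s = 4 * (4:ℝ) ^ (-(n:ℤ)) then π
  else if ∃ n : ℕ, 1 ≤ n ∧ s = 2 * (4:ℝ) ^ (-(n:ℤ)) then 0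
  else if ∃ n : ℕ, 1 ≤ n ∧
      s ∈ Ioo (2 * (4:ℝ) ^ (-(n:ℤ))) (4 * (4:ℝ) ^ (-(n:ℤ)))
  then γ₁ else γ₂

lemma g2_q_succ (n : ℕ) : (4:ℝ) ^ (-((n+1 : ℕ):ℤ)) = (4:ℝ) ^ (-(n:ℤ)) / 4 := by
  push_cast
  rw [neg_add, zpow_add₀ (by norm_num)]
  norm_num [div_eq_mul_inv]

lemma g2_q_pos (n : ℕ) : 0 < (4:ℝ) ^ (-(n:ℤ)) := by positivity

lemma g2_q_le (n : ℕ) : (4:ℝ) ^ (-(n:ℤ)) ≤ 1 := by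
  induction n with
  | zero => simp
  | succ k ih => rw [g2_q_succ]; linarith [g2_q_pos k]

lemma g2_shift (P : ℝ → Prop) (h1 : ¬ P (1/4)) :
    (∃ n : ℕ, 1 ≤ n ∧ P ((4:ℝ) ^ (-(n:ℤ)))) ↔ ∃ n : ℕ, 1 ≤ n ∧ P ((4:ℝ) ^ (-(n:ℤ)) / 4) := by
  constructor
  · rintro ⟨n, hn, h⟩
    obtain ⟨k, rfl⟩ : ∃ k, n = k + 1 := ⟨n - 1, by omega⟩
    rw [g2_q_succ] at h
    refine ⟨k, ?_, h⟩
    rcases Nat.eq_zero_or_pos k with rfl | h0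
    · simp at h h1; exact absurd h h1
    · exact h0
  · rintro ⟨n, hn, h⟩
    exact ⟨n + 1, by omega, by rwa [g2_q_succ]⟩

lemma g2_scale (γ₁ γ₂ t : ℝ) (ht : t < 1/4) :
    gammaEx2 γ₁ γ₂ (4 * t) = gammaEx2 γ₁ γ₂ t := by
  have e1 := g2_shift (fun q => t = 4 * q) (by linarith)
  have e2 := g2_shift (fun q => t = 2 * q) (by linarith)
  have e3 := g2_shift (fun q => t ∈ Ioo (2 * q) (4 * q)) (by rintro ⟨h, -⟩; linarith)
  simp only [gammaEx2]
  rw [e1, e2, e3]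
  have f1 : ∀ q : ℝ, 4 * t = 4 * q ↔ t = 4 * (q / 4) := fun q =>
    ⟨fun h => by linarith, fun h => by linarith⟩
  have f2 : ∀ q : ℝ, 4 * t = 2 * q ↔ t = 2 * (q / 4) := fun q =>
    ⟨fun h => by linarith, fun h => by linarith⟩
  have f3 : ∀ q : ℝ, 4 * t ∈ Ioo (2 * q) (4 * q) ↔ t ∈ Ioo (2 * (q / 4)) (4 * (q / 4)) :=
    fun q => ⟨fun h => ⟨by linarith [h.1], by linarith [h.2]⟩,
      fun h => ⟨by linarith [h.1], by linarith [h.2]⟩⟩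
  simp only [f1, f2, f3]

lemma g2_small (P : ℝ → Prop) (h1 : ¬ P (1/4)) (h : ∀ q : ℝ, 0 < q → q ≤ 1/16 → ¬ P q) :
    ¬ ∃ n : ℕ, 1 ≤ n ∧ P ((4:ℝ) ^ (-(n:ℤ))) := by
  rw [g2_shift P h1]
  rintro ⟨n, hn, hP⟩
  obtain ⟨k, rfl⟩ : ∃ k, n = k + 1 := ⟨n - 1, by omega⟩
  rw [g2_q_succ] at hP
  exact h _ (by linarith [g2_q_pos k]) (by linarith [g2_q_le k]) hP

lemma g2_mid (γ₁ γ₂ t : ℝ) (ht : t ∈ Ioo (1/4:ℝ) (1/2)) : gammaEx2 γ₁ γ₂ t = γ₂ := by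
  obtain ⟨ha, hb⟩ := ht
  have e1 := g2_small (fun q => t = 4 * q) (by intro h; linarith) (by intro q _ _ h; linarith)
  have e2 := g2_small (fun q => t = 2 * q) (by intro h; linarith) (by intro q _ _ h; linarith)
  have e3 := g2_small (fun q => t ∈ Ioo (2 * q) (4 * q)) (by rintro ⟨h, -⟩; linarith)
    (by rintro q _ _ ⟨_, h⟩; linarith)
  simp only [gammaEx2]
  rw [if_neg e1, if_neg e2, if_neg e3]

lemma g2_top (γ₁ γ₂ t : ℝ) (ht : t ∈ Ioo (1/2:ℝ) 1) : gammaEx2 γ₁ γ₂ t = γ₁ := by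
  obtain ⟨ha, hb⟩ := ht
  have e1 := g2_small (fun q => t = 4 * q) (by intro h; linarith) (by intro q _ _ h; linarith)
  have e2 := g2_small (fun q => t = 2 * q) (by intro h; linarith) (by intro q _ _ h; linarith)
  simp only [gammaEx2]
  rw [if_neg e1, if_neg e2, if_pos]
  exact ⟨1, le_rfl, by norm_num; constructor <;> linarith⟩

lemma g2_meas (γ₁ γ₂ : ℝ) : Measurable (gammaEx2 γ₁ γ₂) := by
  unfold gammaEx2
  refine Measurable.ite ?_ measurable_const (Measurable.ite ?_ measurable_const
    (Measurable.ite ?_ measurable_const measurable_const))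
  all_goals
    simp only [ofPred_exists, ofPred_and]
    refine MeasurableSet.iUnion fun n => (MeasurableSet.const _).inter ?_
  · exact measurableSet_singleton _
  · exact measurableSet_singleton _
  · exact measurableSet_Ioo

lemma g2_int (γ₁ γ₂ a b : ℝ) :
    IntervalIntegrable (fun t => Real.cos (gammaEx2 γ₁ γ₂ t)) volume a b := by
  have : IntervalIntegrable (fun _ : ℝ => (1:ℝ)) volume a b := intervalIntegrable_const
  refine this.mono_fun (Real.measurable_cos.comp (g2_meas γ₁ γ₂)).aestronglyMeasurable ?_
  refine Eventually.of_forall fun t => ?_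
  simpa using Real.abs_cos_le_one _

noncomputable def g2F (γ₁ γ₂ x : ℝ) : ℝ := ∫ t in (0:ℝ)..x, Real.cos (gammaEx2 γ₁ γ₂ t)

lemma g2_congr (f : ℝ → ℝ) (c a x : ℝ) (hx : a ≤ x) (h : ∀ t ∈ Ioo a x, f t = c) :
    ∫ t in a..x, f t = c * (x - a) := by
  rw [intervalIntegral.integral_of_le hx, integral_Ioc_eq_integral_Ioo,
    setIntegral_congr_fun measurableSet_Ioo h]
  simp [hx, mul_comm]

lemma g2F_scale (γ₁ γ₂ x : ℝ) (h0 : 0 ≤ x) (hx : x ≤ 1/4) :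
    g2F γ₁ γ₂ (4 * x) = 4 * g2F γ₁ γ₂ x := by
  unfold g2F
  have h := intervalIntegral.mul_integral_comp_mul_left
    (f := fun t => Real.cos (gammaEx2 γ₁ γ₂ t)) (a := 0) (b := x) (4:ℝ)
  rw [mul_zero] at h
  rw [← h]
  congr 1
  rw [intervalIntegral.integral_of_le h0, intervalIntegral.integral_of_le h0,
    integral_Ioc_eq_integral_Ioo, integral_Ioc_eq_integral_Ioo]
  refine setIntegral_congr_fun measurableSet_Ioo fun t ht => ?_
  rw [g2_scale _ _ _ (by linarith [ht.2])]

lemma g2F_mid (γ₁ γ₂ x : ℝ) (h0 : 1/4 ≤ x) (hx : x ≤ 1/2) :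
    g2F γ₁ γ₂ x = g2F γ₁ γ₂ (1/4) + Real.cos γ₂ * (x - 1/4) := by
  unfold g2F
  rw [← intervalIntegral.integral_add_adjacent_intervals (g2_int γ₁ γ₂ 0 (1/4))
    (g2_int γ₁ γ₂ (1/4) x), g2_congr _ (Real.cos γ₂) (1/4) x h0]
  intro t ht
  rw [g2_mid _ _ _ ⟨ht.1, by linarith [ht.2]⟩]

lemma g2F_top (γ₁ γ₂ x : ℝ) (h0 : 1/2 ≤ x) (hx : x ≤ 1) :
    g2F γ₁ γ₂ x = g2F γ₁ γ₂ (1/2) + Real.cos γ₁ * (x - 1/2) := by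
  unfold g2F
  rw [← intervalIntegral.integral_add_adjacent_intervals (g2_int γ₁ γ₂ 0 (1/2))
    (g2_int γ₁ γ₂ (1/2) x), g2_congr _ (Real.cos γ₁) (1/2) x h0]
  intro t ht
  rw [g2_top _ _ _ ⟨ht.1, by linarith [ht.2]⟩]

lemma g2F_quarter (γ₁ γ₂ : ℝ) :
    g2F γ₁ γ₂ (1/4) = (1/4) * ((2/3) * Real.cos γ₁ + (1/3) * Real.cos γ₂) := by
  have a := g2F_scale γ₁ γ₂ (1/4) (by norm_num) le_rfl
  have b := g2F_mid γ₁ γ₂ (1/2) (by norm_num) le_rfl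
  have c := g2F_top γ₁ γ₂ 1 (by norm_num) le_rfl
  norm_num at a b c ⊢
  linarith

lemma g2F_eq (γ₁ γ₂ : ℝ) (n : ℕ) :
    g2F γ₁ γ₂ ((1/2) * (1/4:ℝ)^n) =
      ((1/2) * (1/4:ℝ)^n) * ((1/3) * Real.cos γ₁ + (2/3) * Real.cos γ₂) := by
  induction n with
  | zero =>
    have a := g2F_quarter γ₁ γ₂
    have b := g2F_mid γ₁ γ₂ (1/2) (by norm_num) le_rfl
    simp only [pow_zero, mul_one]
    linarith
  | succ k ih =>
    have h1 : (1/4:ℝ)^k ≤ 1 := pow_le_one₀ (by norm_num) (by norm_num)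
    have a := g2F_scale γ₁ γ₂ ((1/2) * (1/4:ℝ)^(k+1)) (by positivity)
      (by rw [pow_succ]; linarith)
    have e : 4 * ((1/2) * (1/4:ℝ)^(k+1)) = (1/2) * (1/4:ℝ)^k := by rw [pow_succ]; ring
    rw [e, ih] at a
    rw [pow_succ] at a ⊢
    linarith

lemma g2F_ge (γ₁ γ₂ : ℝ) (hc : Real.cos γ₂ ≤ Real.cos γ₁) (n : ℕ) :
    ∀ x : ℝ, (1/4:ℝ)^(n+1) ≤ x → x ≤ 1 →
      x * ((1/3) * Real.cos γ₁ + (2/3) * Real.cos γ₂) ≤ g2F γ₁ γ₂ x := by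
  have base : ∀ x : ℝ, 1/4 ≤ x → x ≤ 1 →
      x * ((1/3) * Real.cos γ₁ + (2/3) * Real.cos γ₂) ≤ g2F γ₁ γ₂ x := by
    intro x hx h1
    have a := g2F_quarter γ₁ γ₂
    have b := g2F_mid γ₁ γ₂ (1/2) (by norm_num) le_rfl
    rcases le_total x (1/2) with h | h
    · have c := g2F_mid γ₁ γ₂ x hx h
      nlinarith
    · have c := g2F_top γ₁ γ₂ x h h1
      nlinarith
  induction n with
  | zero => intro x hx h1; exact base x (by simpa using hx) h1
  | succ k ih =>
    intro x hx h1
    rcases le_total (1/4) x with h | h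
    · exact base x h h1
    · have h0 : 0 ≤ x := le_trans (by positivity) hx
      have := ih (4 * x) (by rw [pow_succ] at hx; linarith) (by linarith)
      rw [g2F_scale _ _ _ h0 h] at this
      linarith

/-- For the contact angle of Example 2 and any `b ∈ (0,1)`,
`liminf_{ε→0⁺} (1/ε) ∫₀^{bε} cos(γ(t)) dt = b·((1/3)cos γ₁ + (2/3)cos γ₂)`. -/
theorem example2_liminf (γ₁ γ₂ : ℝ) (h₁ : 0 ≤ γ₁) (h₁₂ : γ₁ ≤ γ₂) (h₂ : γ₂ ≤ π)
    (b : ℝ) (hb : b ∈ Ioo (0:ℝ) 1) :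
    liminf (fun ε : ℝ => ε⁻¹ * ∫ t in Ioo (0:ℝ) (b * ε), Real.cos (gammaEx2 γ₁ γ₂ t))
        (𝓝[>] (0:ℝ)) =
      b * ((1/3) * Real.cos γ₁ + (2/3) * Real.cos γ₂) := by
  obtain ⟨hb0, hb1⟩ := hb
  have hc : Real.cos γ₂ ≤ Real.cos γ₁ := Real.cos_le_cos_of_nonneg_of_le_pi h₁ h₂ h₁₂
  have hF : ∀ ε : ℝ, 0 < ε →
      ∫ t in Ioo (0:ℝ) (b * ε), Real.cos (gammaEx2 γ₁ γ₂ t) = g2F γ₁ γ₂ (b * ε) := by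
    intro ε hε
    unfold g2F
    rw [intervalIntegral.integral_of_le (by positivity), integral_Ioc_eq_integral_Ioo]
  have hlow : ∀ᶠ ε in 𝓝[>] (0:ℝ), b * ((1/3) * Real.cos γ₁ + (2/3) * Real.cos γ₂) ≤
      ε⁻¹ * ∫ t in Ioo (0:ℝ) (b * ε), Real.cos (gammaEx2 γ₁ γ₂ t) := by
    filter_upwards [Ioo_mem_nhdsGT (show (0:ℝ) < 1 by norm_num)] with ε hε
    rw [hF ε hε.1]
    have hpos : 0 < b * ε := mul_pos hb0 hε.1
    obtain ⟨n, hn⟩ := exists_pow_lt_of_lt_one hpos (show (1/4:ℝ) < 1 by norm_num)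
    have hn' : (1/4:ℝ)^(n+1) ≤ b * ε := by
      rw [pow_succ]; nlinarith [show (0:ℝ) < (1/4:ℝ)^n by positivity]
    have := g2F_ge γ₁ γ₂ hc n (b * ε) hn' (by nlinarith [hε.1, hε.2])
    rw [inv_mul_eq_div, le_div_iff₀ hε.1]
    linarith
  have hfreq : ∃ᶠ ε in 𝓝[>] (0:ℝ),
      ε⁻¹ * ∫ t in Ioo (0:ℝ) (b * ε), Real.cos (gammaEx2 γ₁ γ₂ t) ≤
        b * ((1/3) * Real.cos γ₁ + (2/3) * Real.cos γ₂) := by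
    have ht : Tendsto (fun n : ℕ => ((1/2) * (1/4:ℝ)^n) / b) atTop (𝓝[>] (0:ℝ)) := by
      refine tendsto_nhdsWithin_iff.2 ⟨?_, Eventually.of_forall fun n => ?_⟩
      · have := ((tendsto_pow_atTop_nhds_zero_of_lt_one (show (0:ℝ) ≤ 1/4 by norm_num)
          (by norm_num)).const_mul (1/2:ℝ)).div_const b
        simpa using this
      · show (0:ℝ) < _
        positivity
    refine ht.frequently (Frequently.of_forall fun n => ?_)
    have hp : 0 < ((1/2) * (1/4:ℝ)^n) / b := by positivity
    rw [hF _ hp, mul_div_cancel₀ _ hb0.ne', g2F_eq]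
    apply le_of_eq
    field_simp
  apply le_antisymm
  · exact liminf_le_of_frequently_le hfreq ⟨_, by simpa using hlow⟩
  · exact le_liminf_of_le (IsCoboundedUnder.of_frequently_le hfreq) hlow
end
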